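/- arXiv:1002.0190 — 3 statements merged into one kernel-verified Lean document; each statement's English description precedes it below -/
import Mathlib

section
/- Each colour class in a 4-blocked point set has at most four points. -/
/-- `x` blocks `v` and `w` if `x` lies strictly between `v` and `w`. -/
def Blocks {E : Type*} [AddCommGroup E] [Module ℝ E] (x v w : E) : Prop :=
  x ∈ openSegment ℝ v w

/-- `v` and `w` are visible with respect to `P` if no point of `P` blocks them. -/
def Visible {E : Type*} [AddCommGroup E] [Module ℝ E] (P : Set E) (v w : E) : Prop :=
  ∀ x ∈ P, ¬ Blocks x v w

/-- `c` is a blocked colouring of `P`: distinct points of `P` are visible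
iff they get different colours. -/
def BlockedColouring {E : Type*} [AddCommGroup E] [Module ℝ E] {k : ℕ}
    (P : Set E) (c : E → Fin k) : Prop :=
  ∀ v ∈ P, ∀ w ∈ P, v ≠ w → (Visible P v w ↔ c v ≠ c w)

/-- `P` is `k`-blocked. -/
def KBlocked {E : Type*} [AddCommGroup E] [Module ℝ E] (k : ℕ) (P : Set E) : Prop :=
  P.Finite ∧ ∃ c : E → Fin k, BlockedColouring P c

/-- `P` is `{n₁,…,n_k}`-blocked where `N` is the multiset of colour class sizes. -/
def IsNBlocked {E : Type*} [AddCommGroup E] [Module ℝ E] (N : Multiset ℕ) (P : Set E) : Prop :=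
  P.Finite ∧ ∃ (k : ℕ) (c : E → Fin k), BlockedColouring P c ∧
    N = Finset.univ.val.map (fun i : Fin k => (P ∩ c ⁻¹' {i}).ncard)

/-- A multiset of positive integers is representable if some planar point set is
`N`-blocked. -/
def Representable (N : Multiset ℕ) : Prop :=
  ∃ P : Set (ℝ × ℝ), IsNBlocked N P

/-- A set is in convex position if no point lies in the convex hull of the others. -/
def ConvexPosition {E : Type*} [AddCommGroup E] [Module ℝ E] (K : Set E) : Prop :=
  ∀ x ∈ K, x ∉ convexHull ℝ (K \ {x})

/-- `P` is `N`-midpoint-blocked: `N`-blocked, and midpoints of monochromatic pairs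
belong to `P`. -/
def IsNMidpointBlocked {E : Type*} [AddCommGroup E] [Module ℝ E]
    (N : Multiset ℕ) (P : Set E) : Prop :=
  P.Finite ∧ ∃ (k : ℕ) (c : E → Fin k), BlockedColouring P c ∧
    (∀ v ∈ P, ∀ w ∈ P, v ≠ w → c v = c w → midpoint ℝ v w ∈ P) ∧
    N = Finset.univ.val.map (fun i : Fin k => (P ∩ c ⁻¹' {i}).ncard)

/-- Twice the signed area of the triangle `a b x`. -/
def signedArea (a b x : ℝ × ℝ) : ℝ :=
  (b.1 - a.1) * (x.2 - a.2) - (b.2 - a.2) * (x.1 - a.1)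

theorem signedArea_swap (a b x : ℝ × ℝ) : signedArea b a x = -signedArea a b x := by
  unfold signedArea; ring

theorem signedArea_rotate (a b x : ℝ × ℝ) : signedArea b x a = signedArea a b x := by
  unfold signedArea; ring

theorem signedArea_left (a b : ℝ × ℝ) : signedArea a b a = 0 := by
  unfold signedArea; ring

theorem signedArea_right (a b : ℝ × ℝ) : signedArea a b b = 0 := by
  unfold signedArea; ring

theorem signedArea_self (a x : ℝ × ℝ) : signedArea a a x = 0 := by
  unfold signedArea; ring

section Between

variable {v x w : ℝ × ℝ}

theorem Sbtw.exists_weights (h : Sbtw ℝ v x w) :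
    ∃ s t : ℝ, 0 < s ∧ 0 < t ∧ s + t = 1 ∧
      ∀ a b, signedArea a b x = s * signedArea a b v + t * signedArea a b w := by
  obtain ⟨t, ⟨h0, h1⟩, rfl⟩ := h.mem_image_Ioo
  refine ⟨1 - t, t, by linarith, h0, by ring, fun a b => ?_⟩
  simp only [signedArea, AffineMap.lineMap_apply, vsub_eq_sub, vadd_eq_add, Prod.fst_add,
    Prod.snd_add, Prod.smul_fst, Prod.smul_snd, Prod.fst_sub, Prod.snd_sub, smul_eq_mul]
  ring

theorem Sbtw.signedArea_nonneg (h : Sbtw ℝ v x w) {a b : ℝ × ℝ} (hv : 0 ≤ signedArea a b v)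
    (hw : 0 ≤ signedArea a b w) : 0 ≤ signedArea a b x := by
  obtain ⟨s, t, hs, ht, -, e⟩ := h.exists_weights
  rw [e]; positivity

theorem Sbtw.signedArea_pos_of_left (h : Sbtw ℝ v x w) {a b : ℝ × ℝ}
    (hv : 0 < signedArea a b v) (hw : 0 ≤ signedArea a b w) : 0 < signedArea a b x := by
  obtain ⟨s, t, hs, ht, -, e⟩ := h.exists_weights
  rw [e]; positivity

theorem Sbtw.signedArea_pos_of_right (h : Sbtw ℝ v x w) {a b : ℝ × ℝ}
    (hv : 0 ≤ signedArea a b v) (hw : 0 < signedArea a b w) : 0 < signedArea a b x := by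
  obtain ⟨s, t, hs, ht, -, e⟩ := h.exists_weights
  rw [e]; positivity

theorem Sbtw.signedArea_eq_zero (h : Sbtw ℝ v x w) {a b : ℝ × ℝ} (hv : signedArea a b v = 0)
    (hw : signedArea a b w = 0) : signedArea a b x = 0 := by
  obtain ⟨s, t, hs, ht, -, e⟩ := h.exists_weights
  rw [e, hv, hw]; ring

theorem Sbtw.signedArea_eq_zero_self (h : Sbtw ℝ v x w) : signedArea v w x = 0 :=
  h.signedArea_eq_zero (signedArea_left v w) (signedArea_right v w)

theorem Sbtw.signedArea_ends_eq_zero (h : Sbtw ℝ v x w) {a b : ℝ × ℝ}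
    (hv : 0 ≤ signedArea a b v) (hw : 0 ≤ signedArea a b w) (hx : signedArea a b x = 0) :
    signedArea a b v = 0 ∧ signedArea a b w = 0 := by
  constructor
  · by_contra hne
    exact (h.signedArea_pos_of_left (lt_of_le_of_ne hv (Ne.symm hne)) hw).ne' hx
  · by_contra hne
    exact (h.signedArea_pos_of_right hv (lt_of_le_of_ne hw (Ne.symm hne))).ne' hx

end Between

theorem wbtw_of_signedArea_eq_zero {a b x : ℝ × ℝ} (h : signedArea a b x = 0) :
    Wbtw ℝ a b x ∨ Wbtw ℝ b x a ∨ Wbtw ℝ x a b := by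
  apply Collinear.wbtw_or_wbtw_or_wbtw
  by_cases hab : a = b
  · subst hab
    simpa using collinear_pair ℝ a x
  rw [collinear_iff_of_mem (p₀ := a) (by simp)]
  refine ⟨b - a, ?_⟩
  have key : ∃ t : ℝ, x = t • (b - a) + a := by
    unfold signedArea at h
    by_cases h1 : b.1 - a.1 = 0
    · have h2 : b.2 - a.2 ≠ 0 := by
        intro h2
        exact hab (Prod.ext (by linarith) (by linarith))
      have h3 : x.1 - a.1 = 0 := by
        rw [h1] at h
        simpa [h2] using h
      refine ⟨(x.2 - a.2) / (b.2 - a.2), Prod.ext ?_ ?_⟩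
      · simp [h1]; linarith
      · simp; field_simp; ring
    · refine ⟨(x.1 - a.1) / (b.1 - a.1), Prod.ext ?_ ?_⟩
      · simp; field_simp; ring
      · simp; field_simp; linarith
  intro q hq
  simp only [Set.mem_insert_iff, Set.mem_singleton_iff] at hq
  rcases hq with rfl | rfl | rfl
  · exact ⟨0, by simp⟩
  · exact ⟨1, by simp⟩
  · exact key

/-- A finite set in which any two distinct points of the same colour have a point of the set
strictly between them, and in which no four points are collinear. -/
structure BlockedConfig {κ : Type*} (c : ℝ × ℝ → κ) (S : Set (ℝ × ℝ)) : Prop where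
  finite : S.Finite
  exists_blocker : ∀ v ∈ S, ∀ w ∈ S, v ≠ w → c v = c w → ∃ x ∈ S, Sbtw ℝ v x w
  no_four : ∀ p ∈ S, ∀ q ∈ S, ∀ r ∈ S, ∀ s ∈ S, Sbtw ℝ p q r → Sbtw ℝ q r s → False

theorem BlockedColouring.blockedConfig {k : ℕ} {P : Set (ℝ × ℝ)} {c : ℝ × ℝ → Fin k}
    (hfin : P.Finite) (hc : BlockedColouring P c) : BlockedConfig c P := by
  have hvis : ∀ v ∈ P, ∀ w ∈ P, v ≠ w → c v = c w → ∃ x ∈ P, Sbtw ℝ v x w := by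
    intro v hv w hw hne heq
    have h := mt (hc v hv w hw hne).1 (not_not.2 heq)
    simp only [Visible, Blocks, not_forall, not_not] at h
    obtain ⟨x, hx, hxb⟩ := h
    refine ⟨x, hx, ?_⟩
    rw [openSegment_eq_image_lineMap] at hxb
    exact sbtw_iff_mem_image_Ioo_and_ne.2 ⟨hxb, hne⟩
  have hcol : ∀ v ∈ P, ∀ w ∈ P, ∀ x ∈ P, Sbtw ℝ v x w → c v = c w := by
    intro v hv w hw x hx hb
    by_contra hne
    refine (hc v hv w hw hb.left_ne_right).2 hne x hx ?_
    rw [Blocks, openSegment_eq_image_lineMap]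
    exact hb.mem_image_Ioo
  refine ⟨hfin, hvis, ?_⟩
  intro p hp q hq r hr s hs hpqr hqrs
  obtain ⟨x, ⟨hx, hpx⟩, hmin⟩ :=
    Set.exists_min_image {x | x ∈ P ∧ Sbtw ℝ p x r} (fun x => dist p x)
      (hfin.subset fun x hx => hx.1) ⟨q, hq, hpqr⟩
  have hxrs : Sbtw ℝ x r s := (hpqr.trans_expand_right hqrs).trans_left_right hpx
  have hvisx : Visible P p x := by
    intro y hy hyb
    rw [Blocks, openSegment_eq_image_lineMap] at hyb
    have hpyx : Sbtw ℝ p y x := sbtw_iff_mem_image_Ioo_and_ne.2 ⟨hyb, hpx.left_ne⟩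
    have hle := hmin y ⟨hy, hpx.trans_left hpyx⟩
    have hd := hpyx.wbtw.dist_add_dist
    have := dist_pos.2 hpyx.ne_right
    linarith
  refine (hc p hp x hx hpx.left_ne).1 hvisx ?_
  have h2 := hcol p hp s hs x hx (hpx.trans_expand_left hxrs)
  have h3 := hcol x hx s hs r hr hxrs
  rw [h2, h3]

namespace BlockedConfig

section General

variable {κ : Type*} {c : ℝ × ℝ → κ} {S T : Set (ℝ × ℝ)}

theorem mono (h : BlockedConfig c S) (hT : T ⊆ S)
    (hb : ∀ v ∈ T, ∀ w ∈ T, v ≠ w → c v = c w → ∀ x ∈ S, Sbtw ℝ v x w → x ∈ T) :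
    BlockedConfig c T where
  finite := h.finite.subset hT
  exists_blocker v hv w hw hne heq := by
    obtain ⟨x, hx, hxb⟩ := h.exists_blocker v (hT hv) w (hT hw) hne heq
    exact ⟨x, hb v hv w hw hne heq x hx hxb, hxb⟩
  no_four p hp q hq r hr s hs := h.no_four p (hT hp) q (hT hq) r (hT hr) s (hT hs)

theorem color_ne (h : BlockedConfig c S) {v x w : ℝ × ℝ} (hv : v ∈ S) (hx : x ∈ S) (hw : w ∈ S)
    (hb : Sbtw ℝ v x w) : c x ≠ c v := by
  intro heq
  obtain ⟨y, hy, hyb⟩ := h.exists_blocker v hv x hx hb.left_ne heq.symm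
  exact h.no_four v hv y hy x hx w hw hyb (hb.trans_left_right hyb)

theorem blocker_unique (h : BlockedConfig c S) {v x y w : ℝ × ℝ} (hv : v ∈ S) (hx : x ∈ S)
    (hy : y ∈ S) (hw : w ∈ S) (hxb : Sbtw ℝ v x w) (hyb : Sbtw ℝ v y w) : x = y := by
  by_contra hne
  have hline : signedArea v x y = 0 := by
    obtain ⟨s, t, hs, ht, hst, e⟩ := hxb.exists_weights
    rw [← signedArea_rotate v x y, ← signedArea_rotate x y v, e, signedArea_right,
      ← signedArea_rotate y v w, hyb.signedArea_eq_zero_self]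
    ring
  rcases wbtw_of_signedArea_eq_zero hline with h1 | h1 | h1
  · have hvxy : Sbtw ℝ v x y := ⟨h1, hxb.ne_left, hne⟩
    exact h.no_four v hv x hx y hy w hw hvxy (hyb.trans_left_right hvxy)
  · have hvyx : Sbtw ℝ v y x := ⟨h1.symm, hyb.ne_left, Ne.symm hne⟩
    exact h.no_four v hv y hy x hx w hw hvyx (hxb.trans_left_right hvyx)
  · have hyvx : Sbtw ℝ y v x := ⟨h1, hyb.left_ne, hxb.left_ne⟩
    exact h.no_four y hy v hv x hx w hw hyvx hxb

theorem signedArea_ne_zero (h : BlockedConfig c S) {a b d : ℝ × ℝ} (ha : a ∈ S) (hb : b ∈ S)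
    (hd : d ∈ S) (hab : a ≠ b) (had : a ≠ d) (hbd : b ≠ d) (hcab : c a = c b) (hcad : c a = c d) :
    signedArea a b d ≠ 0 := by
  intro h0
  rcases wbtw_of_signedArea_eq_zero h0 with h1 | h1 | h1
  · exact h.color_ne ha hb hd ⟨h1, hab.symm, hbd⟩ hcab.symm
  · exact h.color_ne hb hd ha ⟨h1, hbd.symm, had.symm⟩ (hcad.symm.trans hcab)
  · exact h.color_ne hd ha hb ⟨h1, had, hab⟩ hcad

/-- A line through two points of one colour holds at most one further point. -/
theorem eq_of_signedArea_eq_zero (h : BlockedConfig c S) {a b v w : ℝ × ℝ} (ha : a ∈ S)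
    (hb : b ∈ S) (hv : v ∈ S) (hw : w ∈ S) (hab : a ≠ b) (hcab : c a = c b)
    (hva : c v ≠ c a) (hwa : c w ≠ c a)
    (hv0 : signedArea a b v = 0) (hw0 : signedArea a b w = 0) : v = w := by
  have key : ∀ u ∈ S, c u ≠ c a → signedArea a b u = 0 → Sbtw ℝ a u b := by
    intro u hu hua hu0
    have hau : u ≠ a := fun e => hua (by rw [e])
    have hbu : u ≠ b := fun e => hua (by rw [e, hcab])
    obtain ⟨e, he, heb⟩ := h.exists_blocker a ha b hb hab hcab
    rcases wbtw_of_signedArea_eq_zero hu0 with h1 | h1 | h1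
    · have habu : Sbtw ℝ a b u := ⟨h1, hab.symm, hbu.symm⟩
      exact (h.no_four a ha e he b hb u hu heb (habu.trans_left_right heb)).elim
    · exact ⟨h1.symm, hau, hbu⟩
    · have huab : Sbtw ℝ u a b := ⟨h1, hau.symm, hab⟩
      exact (h.no_four u hu a ha e he b hb (huab.trans_right_left heb) heb).elim
  exact h.blocker_unique ha hv hw hb (key v hv hva hv0) (key w hw hwa hw0)

/-- A point of the line through two points of one colour does not lie between two points of other
colours that are on the same side of the line. -/
theorem not_sbtw_of_edge (h : BlockedConfig c S) {a b v x w : ℝ × ℝ} (ha : a ∈ S)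
    (hb : b ∈ S) (hv : v ∈ S) (hw : w ∈ S) (hab : a ≠ b) (hcab : c a = c b)
    (hva : c v ≠ c a) (hwa : c w ≠ c a) (hv0 : 0 ≤ signedArea a b v)
    (hw0 : 0 ≤ signedArea a b w) (hx0 : signedArea a b x = 0) : ¬ Sbtw ℝ v x w := by
  intro hb'
  obtain ⟨h1, h2⟩ := hb'.signedArea_ends_eq_zero hv0 hw0 hx0
  exact hb'.left_ne_right (h.eq_of_signedArea_eq_zero ha hb hv hw hab hcab hva hwa h1 h2)

/-- A noncollinear triangle of colour `β` contains a blocked configuration without `β`. -/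
theorem exists_sub_of_triangle (h : BlockedConfig c S) {a b d : ℝ × ℝ} (ha : a ∈ S) (hb : b ∈ S)
    (hd : d ∈ S) (hab : c a = c b) (had : c a = c d) (h0 : signedArea a b d ≠ 0) :
    ∃ T ⊆ S, BlockedConfig c T ∧ (∀ x ∈ T, c x ≠ c a) ∧
      ∃ x ∈ T, ∃ y ∈ T, ∃ z ∈ T, signedArea x y z ≠ 0 := by
  let Q : Set ((ℝ × ℝ) × (ℝ × ℝ) × (ℝ × ℝ)) :=
    {q | (q.1 ∈ S ∧ q.2.1 ∈ S ∧ q.2.2 ∈ S) ∧ (c q.1 = c a ∧ c q.2.1 = c a ∧ c q.2.2 = c a) ∧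
      0 < signedArea q.1 q.2.1 q.2.2}
  have hQfin : Q.Finite :=
    (h.finite.prod (h.finite.prod h.finite)).subset fun q hq => ⟨hq.1.1, hq.1.2.1, hq.1.2.2⟩
  have hQne : Q.Nonempty := by
    rcases lt_or_gt_of_ne h0 with hlt | hgt
    · exact ⟨(b, a, d), ⟨hb, ha, hd⟩, ⟨hab.symm, rfl, had.symm⟩, by
        change 0 < signedArea b a d
        rw [signedArea_swap]; linarith⟩
    · exact ⟨(a, b, d), ⟨ha, hb, hd⟩, ⟨rfl, hab.symm, had.symm⟩, hgt⟩
  obtain ⟨⟨p, q, r⟩, ⟨⟨hp, hq, hr⟩, ⟨hcp, hcq, hcr⟩, hpos⟩, hmin⟩ :=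
    Set.exists_min_image Q (fun q => signedArea q.1 q.2.1 q.2.2) hQfin hQne
  dsimp only at hp hq hr hcp hcq hcr hpos
  have hpq : p ≠ q := by rintro rfl; simp [signedArea_self] at hpos
  have hpr : p ≠ r := by rintro rfl; simp [signedArea_left] at hpos
  have hqr : q ≠ r := by rintro rfl; simp [signedArea_right] at hpos
  have hinner : ∀ x ∈ S, c x = c a → 0 ≤ signedArea p q x → 0 ≤ signedArea q r x →
      0 ≤ signedArea r p x → x = p ∨ x = q ∨ x = r := by
    intro x hx hcx h1 h2 h3
    by_contra! hne
    have n1 := h.signedArea_ne_zero hp hq hx hpq hne.1.symm hne.2.1.symm (by rw [hcp, hcq])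
      (by rw [hcp, hcx])
    have n2 := h.signedArea_ne_zero hq hr hx hqr hne.2.1.symm hne.2.2.symm (by rw [hcq, hcr])
      (by rw [hcq, hcx])
    have p1 := lt_of_le_of_ne h1 n1.symm
    have p2 := lt_of_le_of_ne h2 n2.symm
    have hle := hmin (p, q, x) ⟨⟨hp, hq, hx⟩, ⟨hcp, hcq, hcx⟩, p1⟩
    dsimp only at hle
    unfold signedArea at *
    linarith
  let T : Set (ℝ × ℝ) := {x | x ∈ S ∧ c x ≠ c a ∧ 0 ≤ signedArea p q x ∧ 0 ≤ signedArea q r x ∧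
    0 ≤ signedArea r p x}
  have hqrp : 0 < signedArea q r p := by unfold signedArea at *; linarith
  have hrpq : 0 < signedArea r p q := by unfold signedArea at *; linarith
  have hTS : T ⊆ S := fun x hx => hx.1
  have hT : BlockedConfig c T := by
    refine h.mono hTS ?_
    rintro v ⟨hv, hcv, v1, v2, v3⟩ w ⟨hw, hcw, w1, w2, w3⟩ hne heq x hx hxb
    have x1 := hxb.signedArea_nonneg v1 w1
    have x2 := hxb.signedArea_nonneg v2 w2
    have x3 := hxb.signedArea_nonneg v3 w3
    refine ⟨hx, fun hcx => ?_, x1, x2, x3⟩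
    rcases hinner x hx hcx x1 x2 x3 with rfl | rfl | rfl
    · exact h.not_sbtw_of_edge hp hq hv hw hpq (by rw [hcp, hcq]) (by rwa [hcp]) (by rwa [hcp])
        v1 w1 (signedArea_left _ _) hxb
    · exact h.not_sbtw_of_edge hp hq hv hw hpq (by rw [hcp, hcq]) (by rwa [hcp]) (by rwa [hcp])
        v1 w1 (signedArea_right _ _) hxb
    · exact h.not_sbtw_of_edge hq hr hv hw hqr (by rw [hcq, hcr]) (by rwa [hcq]) (by rwa [hcq])
        v2 w2 (signedArea_right _ _) hxb
  have hmem : ∀ u ∈ S, ∀ w ∈ S, c u = c a → u ≠ w → c u = c w →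
      0 ≤ signedArea p q u → 0 ≤ signedArea q r u → 0 ≤ signedArea r p u →
      0 ≤ signedArea p q w → 0 ≤ signedArea q r w → 0 ≤ signedArea r p w →
      ∃ x ∈ T, Sbtw ℝ u x w := by
    intro u hu w hw hcu hne heq u1 u2 u3 w1 w2 w3
    obtain ⟨x, hx, hxb⟩ := h.exists_blocker u hu w hw hne heq
    exact ⟨x, ⟨hx, by rw [← hcu]; exact h.color_ne hu hx hw hxb, hxb.signedArea_nonneg u1 w1,
      hxb.signedArea_nonneg u2 w2, hxb.signedArea_nonneg u3 w3⟩, hxb⟩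
  obtain ⟨x, hxT, hx⟩ := hmem p hp q hq hcp hpq (by rw [hcp, hcq])
    (signedArea_left _ _).ge hqrp.le (signedArea_right _ _).ge
    (signedArea_right _ _).ge (signedArea_left _ _).ge hrpq.le
  obtain ⟨y, hyT, hy⟩ := hmem q hq r hr hcq hqr (by rw [hcq, hcr])
    (signedArea_right _ _).ge (signedArea_left _ _).ge hrpq.le
    hpos.le (signedArea_right _ _).ge (signedArea_left _ _).ge
  obtain ⟨z, hzT, hz⟩ := hmem r hr p hp hcr hpr.symm (by rw [hcr, hcp])
    hpos.le (signedArea_right _ _).ge (signedArea_left _ _).ge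
    (signedArea_left _ _).ge hqrp.le (signedArea_right _ _).ge
  refine ⟨T, hTS, hT, fun x hx => hx.2.1, x, hxT, y, hyT, z, hzT, ?_⟩
  obtain ⟨s, s', hs, hs', hss, ex⟩ := hx.exists_weights
  obtain ⟨t, t', ht, ht', htt, ey⟩ := hy.exists_weights
  obtain ⟨u, u', hu, hu', huu, ez⟩ := hz.exists_weights
  have e : signedArea x y z = (s * t * u + s' * t' * u') * signedArea p q r := by
    rw [ez, ← signedArea_rotate x y r, ← signedArea_rotate x y p, ex, ex,
      ← signedArea_rotate y r p, ← signedArea_rotate y r q, ← signedArea_rotate y p p,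
      ← signedArea_rotate y p q, ey, ey, ey, ey]
    unfold signedArea
    ring
  rw [e]
  positivity

end General

end BlockedConfig

namespace BlockedConfig

section FewColours

variable {c : ℝ × ℝ → Fin 4} {S : Set (ℝ × ℝ)} {α β : Fin 4}

/-- A blocked configuration with at most two colours is contained in a line. -/
theorem signedArea_eq_zero_of_two_colours (h : BlockedConfig c S) (hαβ : α ≠ β)
    (hα : ∀ x ∈ S, c x ≠ α) (hβ : ∀ x ∈ S, c x ≠ β) {x y z : ℝ × ℝ} (hx : x ∈ S) (hy : y ∈ S)
    (hz : z ∈ S) : signedArea x y z = 0 := by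
  have hmono : ∀ x ∈ S, ∀ y ∈ S, ∀ z ∈ S, c x = c y → c x = c z → signedArea x y z = 0 := by
    intro x hx y hy z hz hxy hxz
    by_contra h0
    obtain ⟨T, hTS, hT, hTc, a, ha, b, hb, d, hd, h1⟩ :=
      h.exists_sub_of_triangle hx hy hz hxy hxz h0
    have hab : a ≠ b := by rintro rfl; simp [signedArea_self] at h1
    have hcol : ∀ u ∈ T, ∀ v ∈ T, c u = c v := by
      intro u hu v hv
      have := hTc u hu
      have := hTc v hv
      have := hα u (hTS hu)
      have := hα v (hTS hv)
      have := hβ u (hTS hu)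
      have := hβ v (hTS hv)
      have := hα x hx
      have := hβ x hx
      omega
    obtain ⟨e, he, heb⟩ := hT.exists_blocker a ha b hb hab (hcol a ha b hb)
    exact hT.color_ne ha he hb heb (hcol e he a ha)
  have hpair : ∀ x ∈ S, ∀ y ∈ S, ∀ z ∈ S, c x = c y → c x ≠ c z → signedArea x y z = 0 := by
    intro x hx y hy z hz hxy hxz
    by_contra h0
    have hne : x ≠ y := by rintro rfl; simp [signedArea_self] at h0
    obtain ⟨e, he, heb⟩ := h.exists_blocker x hx y hy hne hxy
    have hce := h.color_ne hx he hy heb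
    have hcez : c e = c z := by
      have := hα e he; have := hα z hz; have := hβ e he; have := hβ z hz
      have := hα x hx; have := hβ x hx
      omega
    have hez : e ≠ z := by
      rintro rfl
      exact h0 heb.signedArea_eq_zero_self
    obtain ⟨f, hf, hfb⟩ := h.exists_blocker e he z hz hez hcez
    have hcf := h.color_ne he hf hz hfb
    have hcfx : c x = c f := by
      have := hα e he; have := hα f hf; have := hβ e he; have := hβ f hf
      have := hα x hx; have := hβ x hx
      omega
    by_cases hfx : f = x
    · subst hfx
      exact h.no_four y hy e he f hx z hz heb.symm hfb
    by_cases hfy : f = y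
    · subst hfy
      exact h.no_four x hx e he f hy z hz heb hfb
    exact h.signedArea_ne_zero hx hy hf hne (Ne.symm hfx) (Ne.symm hfy) hxy hcfx
      (hmono x hx y hy f hf hxy hcfx)
  by_cases h1 : c x = c y
  · by_cases h2 : c x = c z
    · exact hmono x hx y hy z hz h1 h2
    · exact hpair x hx y hy z hz h1 h2
  · by_cases h2 : c x = c z
    · rw [← signedArea_rotate, ← signedArea_rotate]
      exact hpair z hz x hx y hy h2.symm fun e => h1 (h2.trans e)
    · have h3 : c y = c z := by
        have := hα x hx; have := hβ x hx; have := hα y hy; have := hβ y hy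
        have := hα z hz; have := hβ z hz
        omega
      rw [← signedArea_rotate]
      exact hpair y hy z hz x hx h3 fun e => h1 e.symm

/-- In a blocked configuration with at most three colours, each colour is used at most twice. -/
theorem not_three_of_three_colours (h : BlockedConfig c S) (hα : ∀ x ∈ S, c x ≠ α)
    {x y z : ℝ × ℝ} (hx : x ∈ S) (hy : y ∈ S) (hz : z ∈ S) (hxy : x ≠ y) (hxz : x ≠ z)
    (hyz : y ≠ z) (hcxy : c x = c y) (hcxz : c x = c z) : False := by
  obtain ⟨T, hTS, hT, hTc, a, ha, b, hb, d, hd, h1⟩ :=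
    h.exists_sub_of_triangle hx hy hz hcxy hcxz
      (h.signedArea_ne_zero hx hy hz hxy hxz hyz hcxy hcxz)
  exact h1 (hT.signedArea_eq_zero_of_two_colours (hα x hx) hTc
    (fun u hu => hα u (hTS hu)) ha hb hd)

theorem card_le_six (h : BlockedConfig c S) (hα : ∀ x ∈ S, c x ≠ α) (F : Finset (ℝ × ℝ))
    (hF : ∀ x ∈ F, x ∈ S) : F.card ≤ 6 := by
  by_contra! hlt
  obtain ⟨γ, -, hγ⟩ := Finset.exists_lt_card_fiber_of_mul_lt_card_of_maps_to
    (s := F) (t := Finset.univ.erase α) (f := c) (n := 2)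
    (fun x hx => Finset.mem_erase.2 ⟨hα x (hF x hx), Finset.mem_univ _⟩)
    (by rw [Finset.card_erase_of_mem (Finset.mem_univ _)]; simpa using hlt)
  obtain ⟨x, hx, y, hy, z, hz, hxy, hxz, hyz⟩ := Finset.two_lt_card.1 hγ
  simp only [Finset.mem_filter] at hx hy hz
  exact h.not_three_of_three_colours hα (hF x hx.1) (hF y hy.1) (hF z hz.1) hxy hxz hyz
    (hx.2.trans hy.2.symm) (hx.2.trans hz.2.symm)

/-- Suppose that only three colours occur, and that four of the points are not between two others.
Two of them with the same colour cannot have the other two of different colours. -/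
theorem not_two_one_one (h : BlockedConfig c S) (hα : ∀ x ∈ S, c x ≠ α) {e₁ e₂ e₃ e₄ x : ℝ × ℝ}
    (h₁ : e₁ ∈ S) (h₂ : e₂ ∈ S) (h₃ : e₃ ∈ S) (h₄ : e₄ ∈ S)
    (x₁ : ∀ v ∈ S, ∀ w ∈ S, ¬ Sbtw ℝ v e₁ w) (x₂ : ∀ v ∈ S, ∀ w ∈ S, ¬ Sbtw ℝ v e₂ w)
    (x₃ : ∀ v ∈ S, ∀ w ∈ S, ¬ Sbtw ℝ v e₃ w) (x₄ : ∀ v ∈ S, ∀ w ∈ S, ¬ Sbtw ℝ v e₄ w)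
    (h12 : e₁ ≠ e₂) (c12 : c e₁ = c e₂) (c13 : c e₁ ≠ c e₃) (c14 : c e₁ ≠ c e₄)
    (c34 : c e₃ ≠ c e₄) (hx : x ∈ S) (hxb : Sbtw ℝ e₁ x e₂) : c x ≠ c e₃ := by
  intro cx3
  have hx3 : x ≠ e₃ := by rintro rfl; exact x₃ _ h₁ _ h₂ hxb
  have hthird : ∀ y ∈ S, y ≠ e₁ → y ≠ e₂ → c y ≠ c e₁ := fun y hy hy1 hy2 hcy =>
    h.not_three_of_three_colours hα h₁ h₂ hy h12 hy1.symm hy2.symm c12 hcy.symm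
  obtain ⟨y, hy, hyb⟩ := h.exists_blocker x hx e₃ h₃ hx3 cx3
  have hy1 : y ≠ e₁ := by rintro rfl; exact x₁ _ hx _ h₃ hyb
  have hy2 : y ≠ e₂ := by rintro rfl; exact x₂ _ hx _ h₃ hyb
  have hy4 : y ≠ e₄ := by rintro rfl; exact x₄ _ hx _ h₃ hyb
  have cy1 := hthird y hy hy1 hy2
  have cyx := h.color_ne hx hy h₃ hyb
  have a1 := hα _ h₁
  have a3 := hα _ h₃
  have a4 := hα _ h₄
  have cy4 : c y = c e₄ := by
    have := hα _ hy
    omega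
  obtain ⟨z, hz, hzb⟩ := h.exists_blocker y hy e₄ h₄ hy4 cy4
  have hz1 : z ≠ e₁ := by rintro rfl; exact x₁ _ hy _ h₄ hzb
  have hz2 : z ≠ e₂ := by rintro rfl; exact x₂ _ hy _ h₄ hzb
  have hz3 : z ≠ e₃ := by rintro rfl; exact x₃ _ hy _ h₄ hzb
  have cz1 := hthird z hz hz1 hz2
  have czy := h.color_ne hy hz h₄ hzb
  have cz3 : c z = c e₃ := by
    have := hα _ hz
    omega
  by_cases hzx : z = x
  · subst hzx
    exact h.no_four e₃ h₃ y hy z hx e₄ h₄ hyb.symm hzb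
  · exact h.not_three_of_three_colours hα hx h₃ hz hx3 (Ne.symm hzx) (Ne.symm hz3) cx3
      (cx3.trans cz3.symm)

/-- Suppose that only three colours occur, and that four of the points are not between two others.
If two of these have the same colour, then so do the other two, and every further point is between
both pairs. -/
theorem sbtw_of_extreme (h : BlockedConfig c S) (hα : ∀ x ∈ S, c x ≠ α) {e₁ e₂ e₃ e₄ : ℝ × ℝ}
    (h₁ : e₁ ∈ S) (h₂ : e₂ ∈ S) (h₃ : e₃ ∈ S) (h₄ : e₄ ∈ S)
    (x₁ : ∀ v ∈ S, ∀ w ∈ S, ¬ Sbtw ℝ v e₁ w) (x₂ : ∀ v ∈ S, ∀ w ∈ S, ¬ Sbtw ℝ v e₂ w)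
    (x₃ : ∀ v ∈ S, ∀ w ∈ S, ¬ Sbtw ℝ v e₃ w) (x₄ : ∀ v ∈ S, ∀ w ∈ S, ¬ Sbtw ℝ v e₄ w)
    (h12 : e₁ ≠ e₂) (h13 : e₁ ≠ e₃) (h14 : e₁ ≠ e₄) (h23 : e₂ ≠ e₃) (h24 : e₂ ≠ e₄)
    (h34 : e₃ ≠ e₄) (c12 : c e₁ = c e₂) :
    c e₁ ≠ c e₃ ∧ c e₃ = c e₄ ∧ ∀ d ∈ S, d ≠ e₁ → d ≠ e₂ → d ≠ e₃ → d ≠ e₄ →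
      Sbtw ℝ e₁ d e₂ ∧ Sbtw ℝ e₃ d e₄ := by
  have hthird : ∀ y ∈ S, y ≠ e₁ → y ≠ e₂ → c y ≠ c e₁ := fun y hy hy1 hy2 hcy =>
    h.not_three_of_three_colours hα h₁ h₂ hy h12 hy1.symm hy2.symm c12 hcy.symm
  have c13 := hthird e₃ h₃ h13.symm h23.symm
  have c14 := hthird e₄ h₄ h14.symm h24.symm
  obtain ⟨x, hx, hxb⟩ := h.exists_blocker e₁ h₁ e₂ h₂ h12 c12
  have hx1 := hxb.ne_left
  have hx2 := hxb.ne_right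
  have hx3 : x ≠ e₃ := by rintro rfl; exact x₃ _ h₁ _ h₂ hxb
  have hx4 : x ≠ e₄ := by rintro rfl; exact x₄ _ h₁ _ h₂ hxb
  have a1 := hα _ h₁
  have a3 := hα _ h₃
  have a4 := hα _ h₄
  have ax := hα _ hx
  have c34 : c e₃ = c e₄ := by
    by_contra c34
    have n3 := h.not_two_one_one hα h₁ h₂ h₃ h₄ x₁ x₂ x₃ x₄ h12 c12 c13.symm c14.symm c34 hx hxb
    have n4 := h.not_two_one_one hα h₁ h₂ h₄ h₃ x₁ x₂ x₄ x₃ h12 c12 c14.symm c13.symm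
      (Ne.symm c34) hx hxb
    have n1 := h.color_ne h₁ hx h₂ hxb
    omega
  have hthird' : ∀ y ∈ S, y ≠ e₃ → y ≠ e₄ → c y ≠ c e₃ := fun y hy hy1 hy2 hcy =>
    h.not_three_of_three_colours hα h₃ h₄ hy h34 hy1.symm hy2.symm c34 hcy.symm
  have huniq : ∀ d ∈ S, ∀ f ∈ S, d ≠ e₁ → d ≠ e₂ → d ≠ e₃ → d ≠ e₄ →
      f ≠ e₁ → f ≠ e₂ → f ≠ e₃ → f ≠ e₄ → d = f := by
    intro d hd f hf d1 d2 d3 d4 f1 f2 f3 f4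
    by_contra hdf
    have hcdf : c d = c f := by
      have := hthird d hd d1 d2
      have := hthird' d hd d3 d4
      have := hthird f hf f1 f2
      have := hthird' f hf f3 f4
      have := hα d hd
      have := hα f hf
      omega
    obtain ⟨g, hg, hgb⟩ := h.exists_blocker d hd f hf hdf hcdf
    have g1 : g ≠ e₁ := by rintro rfl; exact x₁ _ hd _ hf hgb
    have g2 : g ≠ e₂ := by rintro rfl; exact x₂ _ hd _ hf hgb
    have g3 : g ≠ e₃ := by rintro rfl; exact x₃ _ hd _ hf hgb
    have g4 : g ≠ e₄ := by rintro rfl; exact x₄ _ hd _ hf hgb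
    have := hthird d hd d1 d2
    have := hthird' d hd d3 d4
    have := hthird g hg g1 g2
    have := hthird' g hg g3 g4
    have := hα d hd
    have := hα g hg
    have := h.color_ne hd hg hf hgb
    omega
  obtain ⟨y, hy, hyb⟩ := h.exists_blocker e₃ h₃ e₄ h₄ h34 c34
  have hy1 : y ≠ e₁ := by rintro rfl; exact x₁ _ h₃ _ h₄ hyb
  have hy2 : y ≠ e₂ := by rintro rfl; exact x₂ _ h₃ _ h₄ hyb
  refine ⟨c13.symm, c34, fun d hd d1 d2 d3 d4 => ?_⟩
  rw [huniq d hd x hx d1 d2 d3 d4 hx1 hx2 hx3 hx4]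
  refine ⟨hxb, ?_⟩
  rw [huniq x hx y hy hx1 hx2 hx3 hx4 hy1 hy2 hyb.ne_left hyb.ne_right]
  exact hyb

end FewColours

end BlockedConfig

theorem signedArea_pos_rotate {a b x : ℝ × ℝ} (h : 0 < signedArea a b x) :
    0 < signedArea b x a := by
  rwa [signedArea_rotate]

theorem signedArea_neg_of_swap {a b x : ℝ × ℝ} (h : 0 < signedArea b a x) :
    signedArea a b x < 0 := by
  rw [signedArea_swap]; linarith

theorem signedArea_pos_of_neg_swap {a b x : ℝ × ℝ} (h : signedArea b a x < 0) :
    0 < signedArea a b x := by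
  rw [signedArea_swap]; linarith

namespace BlockedConfig

section Restrict

variable {κ : Type*} {c : ℝ × ℝ → κ} {S : Set (ℝ × ℝ)} {α : κ}

/-- The points of other colours than `α` in a convex region form a blocked configuration if each
point of colour `α` in the region is on a line through two points of colour `α` that
supports the region. -/
theorem restrict (h : BlockedConfig c S) {K : Set (ℝ × ℝ)}
    (hK : ∀ v ∈ K, ∀ w ∈ K, ∀ x, Sbtw ℝ v x w → x ∈ K)
    (hA : ∀ x ∈ S, c x = α → x ∈ K → ∃ a ∈ S, ∃ b ∈ S, a ≠ b ∧ c a = α ∧ c b = α ∧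
      signedArea a b x = 0 ∧ ∀ y ∈ K, 0 ≤ signedArea a b y) :
    BlockedConfig c {x | x ∈ S ∧ c x ≠ α ∧ x ∈ K} := by
  refine h.mono (fun x hx => hx.1) ?_
  rintro v ⟨hv, hcv, hvK⟩ w ⟨hw, hcw, hwK⟩ - - x hx hxb
  have hxK := hK v hvK w hwK x hxb
  refine ⟨hx, fun hcx => ?_, hxK⟩
  obtain ⟨a, ha, b, hb, hab, hca, hcb, h0, hpos⟩ := hA x hx hcx hxK
  exact h.not_sbtw_of_edge ha hb hv hw hab (hca.trans hcb.symm) (by rwa [hca]) (by rwa [hca])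
    (hpos v hvK) (hpos w hwK) h0 hxb

end Restrict

section FourColours

variable {c : ℝ × ℝ → Fin 4} {S : Set (ℝ × ℝ)} {α : Fin 4}

/-- The blockers of the sides and the diagonals of a convex quadrilateral of colour `α` with no
further point of colour `α`: opposite sides have blockers of the same colour, and the
diagonals have a common blocker, which also blocks both pairs of opposite side blockers. -/
theorem quadrilateral (h : BlockedConfig c S) {p q r s e₁ e₂ e₃ e₄ d d' : ℝ × ℝ}
    (hp : p ∈ S) (hq : q ∈ S) (hr : r ∈ S) (hs : s ∈ S)
    (cp : c p = α) (cq : c q = α) (cr : c r = α) (cs : c s = α)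
    (pqr : 0 < signedArea p q r) (pqs : 0 < signedArea p q s)
    (qrs : 0 < signedArea q r s) (prs : 0 < signedArea p r s)
    (hA : ∀ x ∈ S, c x = α → 0 ≤ signedArea p q x → 0 ≤ signedArea q r x →
      0 ≤ signedArea r s x → 0 ≤ signedArea s p x → x = p ∨ x = q ∨ x = r ∨ x = s)
    (h₁ : e₁ ∈ S) (h₂ : e₂ ∈ S) (h₃ : e₃ ∈ S) (h₄ : e₄ ∈ S) (hd : d ∈ S) (hd' : d' ∈ S)
    (b₁ : Sbtw ℝ p e₁ q) (b₂ : Sbtw ℝ q e₂ r) (b₃ : Sbtw ℝ r e₃ s) (b₄ : Sbtw ℝ s e₄ p)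
    (bd : Sbtw ℝ p d r) (bd' : Sbtw ℝ q d' s) :
    d = d' ∧ Sbtw ℝ e₁ d e₃ ∧ Sbtw ℝ e₂ d e₄ ∧ c e₁ = c e₃ ∧ c e₂ = c e₄ ∧ c e₁ ≠ c e₂ := by
  have qrp := signedArea_pos_rotate pqr
  have rpq := signedArea_pos_rotate qrp
  have qsp := signedArea_pos_rotate pqs
  have spq := signedArea_pos_rotate qsp
  have rsq := signedArea_pos_rotate qrs
  have sqr := signedArea_pos_rotate rsq
  have rsp := signedArea_pos_rotate prs
  have spr := signedArea_pos_rotate rsp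
  have zl := fun a b : ℝ × ℝ => (signedArea_left a b).ge
  have zr := fun a b : ℝ × ℝ => (signedArea_right a b).ge
  let K : Set (ℝ × ℝ) := {x | 0 ≤ signedArea p q x ∧ 0 ≤ signedArea q r x ∧
    0 ≤ signedArea r s x ∧ 0 ≤ signedArea s p x}
  have hK : ∀ v ∈ K, ∀ w ∈ K, ∀ x, Sbtw ℝ v x w → x ∈ K :=
    fun v hv w hw x hb => ⟨hb.signedArea_nonneg hv.1 hw.1, hb.signedArea_nonneg hv.2.1 hw.2.1,
      hb.signedArea_nonneg hv.2.2.1 hw.2.2.1, hb.signedArea_nonneg hv.2.2.2 hw.2.2.2⟩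
  have pK : p ∈ K := ⟨zl _ _, qrp.le, rsp.le, zr _ _⟩
  have qK : q ∈ K := ⟨zr _ _, zl _ _, rsq.le, spq.le⟩
  have rK : r ∈ K := ⟨pqr.le, zr _ _, zl _ _, spr.le⟩
  have sK : s ∈ K := ⟨pqs.le, qrs.le, zr _ _, zl _ _⟩
  have hpq : p ≠ q := b₁.left_ne_right
  have hrs : r ≠ s := b₃.left_ne_right
  have hT := h.restrict (α := α) hK (by
    rintro x hx hcx ⟨k1, k2, k3, k4⟩
    rcases hA x hx hcx k1 k2 k3 k4 with rfl | rfl | rfl | rfl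
    · exact ⟨x, hx, q, hq, hpq, cp, cq, signedArea_left _ _, fun y hy => hy.1⟩
    · exact ⟨p, hp, x, hx, hpq, cp, cq, signedArea_right _ _, fun y hy => hy.1⟩
    · exact ⟨x, hx, s, hs, hrs, cr, cs, signedArea_left _ _, fun y hy => hy.2.2.1⟩
    · exact ⟨r, hr, x, hx, hrs, cr, cs, signedArea_right _ _, fun y hy => hy.2.2.1⟩)
  set T : Set (ℝ × ℝ) := {x | x ∈ S ∧ c x ≠ α ∧ x ∈ K} with hTdef
  have hext : ∀ a ∈ S, ∀ b ∈ S, c a = α → c b = α → (∀ y ∈ K, 0 ≤ signedArea a b y) →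
      ∀ e, Sbtw ℝ a e b → ∀ v ∈ T, ∀ w ∈ T, ¬ Sbtw ℝ v e w := by
    rintro a ha b hb ca cb hpos e he v ⟨hv, hcv, hvK⟩ w ⟨hw, hcw, hwK⟩
    exact h.not_sbtw_of_edge ha hb hv hw he.left_ne_right (ca.trans cb.symm) (by rwa [ca])
      (by rwa [ca]) (hpos v hvK) (hpos w hwK) he.signedArea_eq_zero_self
  have x₁ := hext p hp q hq cp cq (fun y hy => hy.1) e₁ b₁
  have x₂ := hext q hq r hr cq cr (fun y hy => hy.2.1) e₂ b₂
  have x₃ := hext r hr s hs cr cs (fun y hy => hy.2.2.1) e₃ b₃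
  have x₄ := hext s hs p hp cs cp (fun y hy => hy.2.2.2) e₄ b₄
  have hcol : ∀ a ∈ S, ∀ b ∈ S, c a = α → a ∈ K → b ∈ K → ∀ e ∈ S, Sbtw ℝ a e b → e ∈ T :=
    fun a ha b hb ca haK hbK e he hb' =>
      ⟨he, ca ▸ h.color_ne ha he hb hb', hK a haK b hbK e hb'⟩
  have m₁ := hcol p hp q hq cp pK qK e₁ h₁ b₁
  have m₂ := hcol q hq r hr cq qK rK e₂ h₂ b₂
  have m₃ := hcol r hr s hs cr rK sK e₃ h₃ b₃
  have m₄ := hcol s hs p hp cs sK pK e₄ h₄ b₄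
  have md := hcol p hp r hr cp pK rK d hd bd
  have md' := hcol q hq s hs cq qK sK d' hd' bd'
  have hne : ∀ a b e x : ℝ × ℝ, Sbtw ℝ a e b → 0 < signedArea a b x → x ≠ e := by
    rintro a b e x he hpos rfl
    exact hpos.ne' he.signedArea_eq_zero_self
  have n12 := hne p q e₁ e₂ b₁ (b₂.signedArea_pos_of_right (zr _ _) pqr)
  have n13 := hne p q e₁ e₃ b₁ (b₃.signedArea_pos_of_left pqr pqs.le)
  have n14 := hne p q e₁ e₄ b₁ (b₄.signedArea_pos_of_left pqs (zl _ _))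
  have n1d := hne p q e₁ d b₁ (bd.signedArea_pos_of_right (zl _ _) pqr)
  have n1d' := hne p q e₁ d' b₁ (bd'.signedArea_pos_of_right (zr _ _) pqs)
  have n23 := hne q r e₂ e₃ b₂ (b₃.signedArea_pos_of_right (zr _ _) qrs)
  have n24 := hne q r e₂ e₄ b₂ (b₄.signedArea_pos_of_left qrs qrp.le)
  have n2d := hne q r e₂ d b₂ (bd.signedArea_pos_of_left qrp (zr _ _))
  have n2d' := hne q r e₂ d' b₂ (bd'.signedArea_pos_of_right (zl _ _) qrs)
  have n34 := hne r s e₃ e₄ b₃ (b₄.signedArea_pos_of_right (zr _ _) rsp)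
  have n3d := hne r s e₃ d b₃ (bd.signedArea_pos_of_left rsp (zl _ _))
  have n3d' := hne r s e₃ d' b₃ (bd'.signedArea_pos_of_left rsq (zr _ _))
  have n4d := hne s p e₄ d b₄ (bd.signedArea_pos_of_right (zr _ _) spr)
  have n4d' := hne s p e₄ d' b₄ (bd'.signedArea_pos_of_left spq (zl _ _))
  have hα : ∀ x ∈ T, c x ≠ α := fun x hx => hx.2.1
  have c12 : c e₁ ≠ c e₂ := by
    intro heq
    have hb := ((hT.sbtw_of_extreme hα m₁ m₂ m₃ m₄ x₁ x₂ x₃ x₄ n12.symm n13.symm n14.symm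
      n23.symm n24.symm n34.symm heq).2.2 d md n1d n2d n3d n4d).1
    exact hne r p d d bd.symm (hb.signedArea_pos_of_left
      (b₁.signedArea_pos_of_right (zr _ _) rpq) (b₂.signedArea_pos_of_left rpq (zl _ _)).le) rfl
  have c34 : c e₃ ≠ c e₄ := by
    intro heq
    have hb := ((hT.sbtw_of_extreme hα m₃ m₄ m₁ m₂ x₃ x₄ x₁ x₂ n34.symm n13 n23 n14 n24
      n12.symm heq).2.2 d md n3d n4d n1d n2d).1
    exact hne p r d d bd (hb.signedArea_pos_of_left
      (b₃.signedArea_pos_of_right (zr _ _) prs) (b₄.signedArea_pos_of_left prs (zl _ _)).le) rfl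
  have c14 : c e₁ ≠ c e₄ := by
    intro heq
    have hb := ((hT.sbtw_of_extreme hα m₁ m₄ m₂ m₃ x₁ x₄ x₂ x₃ n14.symm n12.symm n13.symm
      n24 n34 n23.symm heq).2.2 d' md' n1d' n4d' n2d' n3d').1
    exact hne q s d' d' bd' (hb.signedArea_pos_of_left
      (b₁.signedArea_pos_of_left qsp (zl _ _)) (b₄.signedArea_pos_of_right (zr _ _) qsp).le) rfl
  have c23 : c e₂ ≠ c e₃ := by
    intro heq
    have hb := ((hT.sbtw_of_extreme hα m₂ m₃ m₁ m₄ x₂ x₃ x₁ x₄ n23.symm n12 n24.symm n13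
      n34.symm n14.symm heq).2.2 d' md' n2d' n3d' n1d' n4d').1
    exact hne s q d' d' bd'.symm (hb.signedArea_pos_of_left
      (b₂.signedArea_pos_of_right (zr _ _) sqr) (b₃.signedArea_pos_of_left sqr (zl _ _)).le) rfl
  have c13 : c e₁ = c e₃ := by
    by_contra hne13
    have c24 : c e₂ = c e₄ := by
      have := hα _ m₁; have := hα _ m₂; have := hα _ m₃; have := hα _ m₄
      omega
    exact hne13 (hT.sbtw_of_extreme hα m₂ m₄ m₁ m₃ x₂ x₄ x₁ x₃ n24.symm n12 n23.symm n14
      n34 n13.symm c24).2.1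
  obtain ⟨-, c24, hbl⟩ := hT.sbtw_of_extreme hα m₁ m₃ m₂ m₄ x₁ x₃ x₂ x₄ n13.symm n12.symm
    n14.symm n23 n34.symm n24.symm c13
  obtain ⟨hb1, hb2⟩ := hbl d md n1d n3d n2d n4d
  obtain ⟨hb1', -⟩ := hbl d' md' n1d' n3d' n2d' n4d'
  exact ⟨hT.blocker_unique m₁ md md' m₃ hb1 hb1', hb1, hb2, c13, c24, c12⟩

/-- A blocked configuration with three colours and five given points has at most one more. -/
theorem eq_of_five (h : BlockedConfig c S) (hα : ∀ x ∈ S, c x ≠ α) {e f g i k z z' : ℝ × ℝ}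
    (hnd : [e, f, g, i, k].Nodup) (hS : ∀ x ∈ [e, f, g, i, k], x ∈ S) (hz : z ∈ S) (hz' : z' ∈ S)
    (hzn : z ∉ [e, f, g, i, k]) (hzn' : z' ∉ [e, f, g, i, k]) : z = z' := by
  by_contra hne
  have hnd' : [z, z', e, f, g, i, k].Nodup :=
    List.nodup_cons.2 ⟨by simpa [hne] using hzn, List.nodup_cons.2 ⟨hzn', hnd⟩⟩
  have hle := h.card_le_six hα [z, z', e, f, g, i, k].toFinset (by
    intro x hx
    rw [List.mem_toFinset, List.mem_cons, List.mem_cons] at hx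
    rcases hx with rfl | rfl | hx
    exacts [hz, hz', hS x hx])
  rw [List.toFinset_card_of_nodup hnd'] at hle
  simp at hle

/-- Three points of one colour have distinct blockers for pairs that share a point. -/
theorem not_common_blocker (h : BlockedConfig c S) {x y w z : ℝ × ℝ} (hx : x ∈ S)
    (hy : y ∈ S) (hw : w ∈ S) (hyw : y ≠ w) (cxy : c x = c y) (cxw : c x = c w)
    (hb : Sbtw ℝ x z y) (hb' : Sbtw ℝ x z w) : False := by
  refine h.signedArea_ne_zero hx hy hw hb.left_ne_right hb'.left_ne_right hyw cxy cxw ?_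
  obtain ⟨s, t, -, ht, -, e⟩ := hb'.exists_weights
  have h1 := e x y
  rw [hb.signedArea_eq_zero_self, signedArea_left, mul_zero, zero_add] at h1
  exact (mul_eq_zero.1 h1.symm).resolve_left ht.ne'

end FourColours

end BlockedConfig

namespace BlockedConfig

section ThreeTriangles

variable {c : ℝ × ℝ → Fin 4} {S U : Set (ℝ × ℝ)} {α : Fin 4} {e f g i k y₁ y₂ z : ℝ × ℝ}
  {I₁ I₂ I₃ : Set (ℝ × ℝ)}

/-- A three-coloured configuration with five given points cannot have a sixth point
in the first of the three disjoint regions that hold the blockers of the triangles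
`i f y₁`, `f g e` and `g k y₂`. -/
theorem not_mem_region (h : BlockedConfig c S) (hU : BlockedConfig c U) (hUS : U ⊆ S)
    (hα : ∀ x ∈ U, c x ≠ α) (hnd : [e, f, g, i, k].Nodup) (hmem : ∀ x ∈ [e, f, g, i, k], x ∈ U)
    (hy₁ : y₁ ∈ S) (hcα : c y₁ ≠ α) (hcy : c y₁ = c y₂) (hcey : c e ≠ c y₁)
    (hyf : y₁ ≠ f) (hyi : y₁ ≠ i) (hyg : y₂ ≠ g) (hyk : y₂ ≠ k)
    (h12 : ∀ z ∈ I₁, z ∉ I₂) (h13 : ∀ z ∈ I₁, z ∉ I₃)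
    (n₁ : ∀ z ∈ I₁, z ∉ [e, f, g, i, k]) (n₂ : ∀ z ∈ I₂, z ∉ [e, f, g, i, k])
    (n₃ : ∀ z ∈ I₃, z ∉ [e, f, g, i, k])
    (t₁ : ∀ v ∈ [i, f, y₁], ∀ w ∈ [i, f, y₁], v ≠ w → c v = c w → ∃ z ∈ U ∩ I₁, Sbtw ℝ v z w)
    (t₂ : ∀ v ∈ [f, g, e], ∀ w ∈ [f, g, e], v ≠ w → c v = c w → ∃ z ∈ U ∩ I₂, Sbtw ℝ v z w)
    (t₃ : ∀ v ∈ [g, k, y₂], ∀ w ∈ [g, k, y₂], v ≠ w → c v = c w → ∃ z ∈ U ∩ I₃, Sbtw ℝ v z w)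
    (hz : z ∈ U) : z ∉ I₁ := by
  intro hz₁
  have huniq : ∀ x ∈ U, x ∉ [e, f, g, i, k] → x = z := fun x hx hxn =>
    hU.eq_of_five hα hnd hmem hx hz hxn (n₁ z hz₁)
  have r₂ : ∀ v ∈ [f, g, e], ∀ w ∈ [f, g, e], v ≠ w → c v ≠ c w := by
    intro v hv w hw hne heq
    obtain ⟨x, hx, -⟩ := t₂ v hv w hw hne heq
    exact h12 z hz₁ (huniq x hx.1 (n₂ x hx.2) ▸ hx.2)
  have r₃ : ∀ v ∈ [g, k, y₂], ∀ w ∈ [g, k, y₂], v ≠ w → c v ≠ c w := by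
    intro v hv w hw hne heq
    obtain ⟨x, hx, -⟩ := t₃ v hv w hw hne heq
    exact h13 z hz₁ (huniq x hx.1 (n₃ x hx.2) ▸ hx.2)
  have nd := hnd
  simp only [List.nodup_cons, List.mem_cons, List.not_mem_nil, or_false, not_or] at nd
  obtain ⟨⟨ef, eg, ei, ek⟩, ⟨fg, fi, fk⟩, ⟨gi, gk⟩, ik, -⟩ := nd
  have me := hmem e (by simp)
  have mf := hmem f (by simp)
  have mg := hmem g (by simp)
  have mi := hmem i (by simp)
  have mk := hmem k (by simp)
  have c1 := r₂ f (by simp) g (by simp) fg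
  have c2 := r₂ f (by simp) e (by simp) (Ne.symm ef)
  have c3 := r₂ g (by simp) e (by simp) (Ne.symm eg)
  have c4 := r₃ g (by simp) k (by simp) gk
  have c5 := r₃ g (by simp) y₂ (by simp) hyg.symm
  have c6 := r₃ k (by simp) y₂ (by simp) hyk.symm
  have ae := hα e me
  have af := hα f mf
  have ag := hα g mg
  have ai := hα i mi
  have ak := hα k mk
  have cke : c e = c k := by omega
  have cfy : c f = c y₁ := by omega
  obtain ⟨x, ⟨hx, hx₁⟩, hxb⟩ := t₁ f (by simp) y₁ (by simp) hyf.symm cfy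
  have hxn := n₁ x hx₁
  have hxz := huniq x hx hxn
  simp only [List.mem_cons, List.not_mem_nil, or_false, not_or] at hxn
  have cxf := h.color_ne (hUS mf) (hUS hx) hy₁ hxb
  have cxe : c x ≠ c e := fun heq =>
    hU.not_three_of_three_colours hα me mk hx ek (Ne.symm hxn.1) (Ne.symm hxn.2.2.2.2) cke heq.symm
  have ax := hα x hx
  have cie : c i ≠ c e := fun heq =>
    hU.not_three_of_three_colours hα me mk mi ek ei (Ne.symm ik) cke heq.symm
  have cgx : c g = c x := by omega
  have cig : c i ≠ c g := fun heq =>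
    hU.not_three_of_three_colours hα mg hx mi (Ne.symm hxn.2.2.1) gi hxn.2.2.2.1 cgx heq.symm
  have cfi : c f = c i := by omega
  obtain ⟨w, ⟨hw, hw₁⟩, hwb⟩ := t₁ f (by simp) i (by simp) fi cfi
  rw [huniq w hw (n₁ w hw₁), ← hxz] at hwb
  exact h.not_common_blocker (hUS mf) hy₁ (hUS mi) hyi cfy cfi hxb hwb

/-- There is no three-coloured configuration with five points for which three disjoint regions
hold the blockers of the triangles `i f y₁`, `f g e` and `g k y₂`. -/
theorem three_triangles (h : BlockedConfig c S) (hU : BlockedConfig c U) (hUS : U ⊆ S)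
    (hα : ∀ x ∈ U, c x ≠ α) (hnd : [e, f, g, i, k].Nodup) (hmem : ∀ x ∈ [e, f, g, i, k], x ∈ U)
    (hy₁ : y₁ ∈ S) (hy₂ : y₂ ∈ S) (hcα : c y₁ ≠ α) (hcy : c y₁ = c y₂) (hcey : c e ≠ c y₁)
    (hyf : y₁ ≠ f) (hyi : y₁ ≠ i) (hyg : y₂ ≠ g) (hyk : y₂ ≠ k)
    (h12 : ∀ z ∈ I₁, z ∉ I₂) (h13 : ∀ z ∈ I₁, z ∉ I₃) (h23 : ∀ z ∈ I₂, z ∉ I₃)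
    (n₁ : ∀ z ∈ I₁, z ∉ [e, f, g, i, k]) (n₂ : ∀ z ∈ I₂, z ∉ [e, f, g, i, k])
    (n₃ : ∀ z ∈ I₃, z ∉ [e, f, g, i, k])
    (t₁ : ∀ v ∈ [i, f, y₁], ∀ w ∈ [i, f, y₁], v ≠ w → c v = c w → ∃ z ∈ U ∩ I₁, Sbtw ℝ v z w)
    (t₂ : ∀ v ∈ [f, g, e], ∀ w ∈ [f, g, e], v ≠ w → c v = c w → ∃ z ∈ U ∩ I₂, Sbtw ℝ v z w)
    (t₃ : ∀ v ∈ [g, k, y₂], ∀ w ∈ [g, k, y₂], v ≠ w → c v = c w → ∃ z ∈ U ∩ I₃, Sbtw ℝ v z w) :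
    False := by
  have k₁ : ∀ z ∈ U, z ∉ I₁ := fun z hz =>
    h.not_mem_region hU hUS hα hnd hmem hy₁ hcα hcy hcey hyf hyi hyg hyk h12 h13 n₁ n₂ n₃
      t₁ t₂ t₃ hz
  have hperm : [e, f, g, i, k].Perm [e, g, f, k, i] :=
    List.Perm.cons _ ((List.Perm.swap _ _ _).trans
      (List.Perm.cons _ (List.Perm.cons _ (List.Perm.swap _ _ _))))
  have flip : ∀ (x : ℝ × ℝ) {a b d : ℝ × ℝ}, x ∈ [a, b, d] → x ∈ [b, a, d] := by
    intro x a b d hx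
    simp only [List.mem_cons, List.not_mem_nil, or_false] at hx ⊢
    tauto
  have k₃ : ∀ z ∈ U, z ∉ I₃ := fun z hz =>
    h.not_mem_region hU hUS hα (hperm.nodup_iff.1 hnd) (fun x hx => hmem x (hperm.mem_iff.2 hx))
      hy₂ (hcy ▸ hcα) hcy.symm (hcy ▸ hcey) hyg hyk hyf hyi (fun z h3 h2 => h23 z h2 h3)
      (fun z h3 h1 => h13 z h1 h3) (fun z hz hn => n₃ z hz (hperm.mem_iff.2 hn))
      (fun z hz hn => n₂ z hz (hperm.mem_iff.2 hn)) (fun z hz hn => n₁ z hz (hperm.mem_iff.2 hn))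
      (fun v hv w hw => t₃ v (flip v hv) w (flip w hw))
      (fun v hv w hw => t₂ v (flip v hv) w (flip w hw))
      (fun v hv w hw => t₁ v (flip v hv) w (flip w hw)) hz
  have nd := hnd
  simp only [List.nodup_cons, List.mem_cons, List.not_mem_nil, or_false, not_or] at nd
  obtain ⟨⟨ef, eg, ei, ek⟩, ⟨fg, fi, fk⟩, ⟨gi, gk⟩, ik, -⟩ := nd
  have me := hmem e (by simp)
  have r₁ : ∀ v ∈ [i, f, y₁], ∀ w ∈ [i, f, y₁], v ≠ w → c v ≠ c w := by
    intro v hv w hw hne heq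
    obtain ⟨x, hx, -⟩ := t₁ v hv w hw hne heq
    exact k₁ x hx.1 hx.2
  have r₃ : ∀ v ∈ [g, k, y₂], ∀ w ∈ [g, k, y₂], v ≠ w → c v ≠ c w := by
    intro v hv w hw hne heq
    obtain ⟨x, hx, -⟩ := t₃ v hv w hw hne heq
    exact k₃ x hx.1 hx.2
  have ae := hα e me
  have hX₁ : ∃ x ∈ [i, f], c x = c e := by
    have := r₁ i (by simp) f (by simp) (Ne.symm fi)
    have := r₁ i (by simp) y₁ (by simp) hyi.symm
    have := r₁ f (by simp) y₁ (by simp) hyf.symm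
    have := hα i (hmem i (by simp))
    have := hα f (hmem f (by simp))
    by_cases hi : c i = c e
    · exact ⟨i, by simp, hi⟩
    · exact ⟨f, by simp, by omega⟩
  have hX₃ : ∃ x ∈ [g, k], c x = c e := by
    have := r₃ g (by simp) k (by simp) gk
    have := r₃ g (by simp) y₂ (by simp) hyg.symm
    have := r₃ k (by simp) y₂ (by simp) hyk.symm
    have := hα g (hmem g (by simp))
    have := hα k (hmem k (by simp))
    by_cases hi : c g = c e
    · exact ⟨g, by simp, hi⟩
    · exact ⟨k, by simp, by omega⟩
  obtain ⟨x, hx, cx⟩ := hX₁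
  obtain ⟨y, hy, cy⟩ := hX₃
  have key : ∀ x y, x ∈ [e, f, g, i, k] → y ∈ [e, f, g, i, k] → e ≠ x → e ≠ y → x ≠ y →
      c x = c e → c y = c e → False := fun x y mx my ex ey xy cx cy =>
    hU.not_three_of_three_colours hα me (hmem x mx) (hmem y my) ex ey xy cx.symm cy.symm
  simp only [List.mem_cons, List.not_mem_nil, or_false] at hx hy
  rcases hx with rfl | rfl <;> rcases hy with rfl | rfl
  · exact key x y (by simp) (by simp) ei eg (Ne.symm gi) cx cy
  · exact key x y (by simp) (by simp) ei ek ik cx cy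
  · exact key x y (by simp) (by simp) ef eg fg cx cy
  · exact key x y (by simp) (by simp) ef ek fk cx cy

end ThreeTriangles

end BlockedConfig

theorem Sbtw.signedArea_pos_of_list {l : List (ℝ × ℝ)} {a b x₀ v z w : ℝ × ℝ}
    (h : Sbtw ℝ v z w) (h₀ : 0 ≤ signedArea a b x₀)
    (hl : ∀ x ∈ l, x = x₀ ∨ 0 < signedArea a b x) (hv : v ∈ l) (hw : w ∈ l) :
    0 < signedArea a b z := by
  rcases hl v hv with rfl | hv'
  · rcases hl w hw with rfl | hw'
    · exact (h.left_ne_right rfl).elim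
    · exact h.signedArea_pos_of_right h₀ hw'
  · rcases hl w hw with rfl | hw'
    · exact h.signedArea_pos_of_left hv' h₀
    · exact h.signedArea_pos_of_left hv' hw'.le

namespace BlockedConfig

section TwoInside

variable {c : ℝ × ℝ → Fin 4} {S : Set (ℝ × ℝ)} {α : Fin 4}

/-- A three-coloured configuration in which two monochromatic pairs of different
colours have a common blocker has no further point. -/
theorem mem_of_cross (h : BlockedConfig c S) (hα : ∀ x ∈ S, c x ≠ α) {a e y₁ y₂ o x : ℝ × ℝ}
    (ha : a ∈ S) (he : e ∈ S) (hy₁ : y₁ ∈ S) (hy₂ : y₂ ∈ S) (ho : o ∈ S)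
    (hae : Sbtw ℝ a o e) (hyy : Sbtw ℝ y₂ o y₁) (cae : c a = c e) (cyy : c y₂ = c y₁)
    (cay : c a ≠ c y₂) (hx : x ∈ S) : x ∈ [a, e, y₁, y₂, o] := by
  by_contra hn
  simp only [List.mem_cons, List.not_mem_nil, or_false, not_or] at hn
  obtain ⟨xa, xe, x1, x2, xo⟩ := hn
  have full : ∀ w ∈ S, w ≠ a → w ≠ e → c w ≠ c a := fun w hw wa we heq =>
    h.not_three_of_three_colours hα ha he hw hae.left_ne_right wa.symm we.symm cae heq.symm
  have full' : ∀ w ∈ S, w ≠ y₂ → w ≠ y₁ → c w ≠ c y₂ := fun w hw wa we heq =>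
    h.not_three_of_three_colours hα hy₂ hy₁ hw hyy.left_ne_right wa.symm we.symm cyy heq.symm
  have cxo : c x = c o := by
    have := full x hx xa xe
    have := full' x hx x2 x1
    have := h.color_ne ha ho he hae
    have := h.color_ne hy₂ ho hy₁ hyy
    have := hα x hx
    have := hα o ho
    have := hα a ha
    have := hα y₂ hy₂
    omega
  obtain ⟨w, hw, hwb⟩ := h.exists_blocker x hx o ho xo cxo
  have wa : w ≠ a := by
    rintro rfl
    exact h.no_four x hx w hw o ho e he hwb hae
  have we : w ≠ e := by
    rintro rfl
    exact h.no_four x hx w hw o ho a ha hwb hae.symm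
  have w1 : w ≠ y₁ := by
    rintro rfl
    exact h.no_four x hx w hw o ho y₂ hy₂ hwb hyy.symm
  have w2 : w ≠ y₂ := by
    rintro rfl
    exact h.no_four x hx w hw o ho y₁ hy₁ hwb hyy
  have := full w hw wa we
  have := full' w hw w2 w1
  have := h.color_ne hx hw ho hwb
  have := h.color_ne ha ho he hae
  have := h.color_ne hy₂ ho hy₁ hyy
  have := hα w hw
  have := hα x hx
  have := hα a ha
  have := hα y₂ hy₂
  omega

variable {p q r u v : ℝ × ℝ}

/-- Let `u` and `v` be inside the triangle `p q r`, with `q u v r` the order around `p`. The points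
of the triangle on the other side of `u v` than `p` are off the lines `p q` and `p r` and
inside the quadrilateral `q r v u`. -/
theorem below_of_two_inside (h : BlockedConfig c S)
    (hp : p ∈ S) (hq : q ∈ S) (hr : r ∈ S) (hu : u ∈ S) (hv : v ∈ S)
    (cp : c p = α) (cq : c q = α) (cr : c r = α) (cu : c u = α) (cv : c v = α)
    (hA : ∀ x ∈ S, c x = α → x ∈ [p, q, r, u, v])
    (pqu : 0 < signedArea p q u) (pqv : 0 < signedArea p q v) (pqr : 0 < signedArea p q r)
    (puv : 0 < signedArea p u v) (pur : 0 < signedArea p u r) (pvr : 0 < signedArea p v r)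
    (vuq : 0 < signedArea v u q) (ruq : 0 < signedArea r u q) (rvq : 0 < signedArea r v q)
    (rvu : 0 < signedArea r v u) :
    ∃ e ∈ S, ∃ y₁ ∈ S, ∃ y₂ ∈ S, Sbtw ℝ u e v ∧ Sbtw ℝ u y₁ q ∧ Sbtw ℝ r y₂ v ∧
      c e ≠ c y₁ ∧ c y₁ = c y₂ ∧
      ∀ x ∈ S, c x ≠ α → 0 ≤ signedArea v u x → 0 ≤ signedArea p q x → 0 ≤ signedArea q r x →
        0 ≤ signedArea r p x →
        0 < signedArea p q x ∧ 0 < signedArea r p x ∧ 0 ≤ signedArea u q x ∧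
          0 ≤ signedArea r v x := by
  have zl := fun a b : ℝ × ℝ => (signedArea_left a b).ge
  have zr := fun a b : ℝ × ℝ => (signedArea_right a b).ge
  have ne : ∀ {a b x : ℝ × ℝ}, 0 < signedArea a b x → a ≠ b ∧ b ≠ x ∧ x ≠ a := by
    intro a b x hpos
    refine ⟨?_, ?_, ?_⟩ <;> rintro rfl <;>
      simp [signedArea_self, signedArea_left, signedArea_right] at hpos
  have uqv := signedArea_pos_rotate vuq
  have qvu := signedArea_pos_rotate uqv
  have uqr := signedArea_pos_rotate ruq
  have qru := signedArea_pos_rotate uqr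
  have vqr := signedArea_pos_rotate rvq
  have qrv := signedArea_pos_rotate vqr
  have vur := signedArea_pos_rotate rvu
  have rpu := signedArea_pos_rotate (signedArea_pos_rotate pur)
  have rpv := signedArea_pos_rotate (signedArea_pos_rotate pvr)
  have rpq := signedArea_pos_rotate (signedArea_pos_rotate pqr)
  have vup : signedArea v u p < 0 :=
    signedArea_neg_of_swap (signedArea_pos_rotate puv)
  obtain ⟨a, ha, ba⟩ := h.exists_blocker q hq r hr (ne pqr).2.1 (by rw [cq, cr])
  obtain ⟨y₂, hy₂, b₂⟩ := h.exists_blocker r hr v hv (ne rvu).1 (by rw [cr, cv])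
  obtain ⟨e, he, be⟩ := h.exists_blocker v hv u hu (ne rvu).2.1 (by rw [cv, cu])
  obtain ⟨y₁, hy₁, b₁⟩ := h.exists_blocker u hu q hq (ne vuq).2.1 (by rw [cu, cq])
  obtain ⟨o, ho, bo⟩ := h.exists_blocker q hq v hv (ne vuq).2.2 (by rw [cq, cv])
  obtain ⟨o', ho', bo'⟩ := h.exists_blocker r hr u hu (ne rvu).2.2.symm (by rw [cr, cu])
  obtain ⟨-, hae, hyy, cae, cyy, cay⟩ := h.quadrilateral hq hr hv hu cq cr cv cu qrv qru rvu qvu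
    (by
      intro x hx hcx _ _ h3 _
      have := hA x hx hcx
      simp only [List.mem_cons, List.not_mem_nil, or_false] at this
      rcases this with rfl | this
      · exact (h3.not_gt vup).elim
      · tauto)
    ha hy₂ he hy₁ ho ho' ba b₂ be b₁ bo bo'
  refine ⟨e, he, y₁, hy₁, y₂, hy₂, be.symm, b₁, b₂, by rwa [← cae, ← cyy], cyy.symm, ?_⟩
  let K : Set (ℝ × ℝ) := {x | 0 ≤ signedArea v u x ∧ 0 ≤ signedArea p q x ∧
    0 ≤ signedArea q r x ∧ 0 ≤ signedArea r p x}
  have hK : ∀ v ∈ K, ∀ w ∈ K, ∀ x, Sbtw ℝ v x w → x ∈ K :=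
    fun v hv w hw x hb => ⟨hb.signedArea_nonneg hv.1 hw.1, hb.signedArea_nonneg hv.2.1 hw.2.1,
      hb.signedArea_nonneg hv.2.2.1 hw.2.2.1, hb.signedArea_nonneg hv.2.2.2 hw.2.2.2⟩
  have qK : q ∈ K := ⟨vuq.le, zr _ _, zl _ _, rpq.le⟩
  have rK : r ∈ K := ⟨vur.le, pqr.le, zr _ _, zl _ _⟩
  have uK : u ∈ K := ⟨zr _ _, pqu.le, qru.le, rpu.le⟩
  have vK : v ∈ K := ⟨zl _ _, pqv.le, qrv.le, rpv.le⟩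
  have hT := h.restrict (α := α) hK (by
    rintro x hx hcx hxK
    have := hA x hx hcx
    simp only [List.mem_cons, List.not_mem_nil, or_false] at this
    rcases this with rfl | rfl | rfl | rfl | rfl
    · exact (hxK.1.not_gt vup).elim
    · exact ⟨p, hp, x, hx, (ne pqr).1, cp, cq, signedArea_right _ _, fun y hy => hy.2.1⟩
    · exact ⟨q, hq, x, hx, (ne pqr).2.1, cq, cr, signedArea_right _ _, fun y hy => hy.2.2.1⟩
    · exact ⟨v, hv, x, hx, (ne rvu).2.1, cv, cu, signedArea_right _ _, fun y hy => hy.1⟩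
    · exact ⟨x, hx, u, hu, (ne rvu).2.1, cv, cu, signedArea_left _ _, fun y hy => hy.1⟩)
  have mT : ∀ {s t x : ℝ × ℝ}, s ∈ S → t ∈ S → c s = α → s ∈ K → t ∈ K → x ∈ S → Sbtw ℝ s x t →
      x ∈ {x | x ∈ S ∧ c x ≠ α ∧ x ∈ K} := fun hs ht cs hsK htK hx hb =>
    ⟨hx, fun hcx => h.color_ne hs hx ht hb (hcx.trans cs.symm), hK _ hsK _ htK _ hb⟩
  intro x hx hcx k1 k2 k3 k4
  have hmem := hT.mem_of_cross (fun x hx => hx.2.1) (mT hq hr cq qK rK ha ba)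
    (mT hv hu cv vK uK he be) (mT hu hq cu uK qK hy₁ b₁) (mT hr hv cr rK vK hy₂ b₂)
    (mT hq hv cq qK vK ho bo) hae hyy cae cyy cay (x := x) ⟨hx, hcx, k1, k2, k3, k4⟩
  simp only [List.mem_cons, List.not_mem_nil, or_false] at hmem
  rcases hmem with rfl | rfl | rfl | rfl | rfl
  · exact ⟨ba.signedArea_pos_of_right (zr _ _) pqr, ba.signedArea_pos_of_left rpq (zl _ _),
      ba.signedArea_nonneg (zr _ _) uqr.le, ba.signedArea_nonneg rvq.le (zl _ _)⟩
  · exact ⟨be.signedArea_pos_of_right pqv.le pqu, be.signedArea_pos_of_left rpv rpu.le,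
      be.signedArea_nonneg uqv.le (zl _ _), be.signedArea_nonneg (zr _ _) rvu.le⟩
  · exact ⟨b₁.signedArea_pos_of_left pqu (zr _ _), b₁.signedArea_pos_of_left rpu rpq.le,
      b₁.signedArea_nonneg (zl _ _) (zr _ _), b₁.signedArea_nonneg rvu.le rvq.le⟩
  · exact ⟨b₂.signedArea_pos_of_left pqr pqv.le, b₂.signedArea_pos_of_right (zl _ _) rpv,
      b₂.signedArea_nonneg uqr.le uqv.le, b₂.signedArea_nonneg (zl _ _) (zr _ _)⟩
  · exact ⟨bo.signedArea_pos_of_right (zr _ _) pqv, bo.signedArea_pos_of_left rpq rpv.le,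
      bo.signedArea_nonneg (zr _ _) uqv.le, bo.signedArea_nonneg rvq.le (zr _ _)⟩

/-- A four-coloured blocked configuration cannot have exactly five points of a colour `α` such that
two of them are inside the triangle formed by the others. -/
theorem not_two_inside (h : BlockedConfig c S)
    (hp : p ∈ S) (hq : q ∈ S) (hr : r ∈ S) (hu : u ∈ S) (hv : v ∈ S)
    (cp : c p = α) (cq : c q = α) (cr : c r = α) (cu : c u = α) (cv : c v = α)
    (hA : ∀ x ∈ S, c x = α → x ∈ [p, q, r, u, v])
    (pqu : 0 < signedArea p q u) (pqv : 0 < signedArea p q v) (pqr : 0 < signedArea p q r)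
    (puv : 0 < signedArea p u v) (pur : 0 < signedArea p u r) (pvr : 0 < signedArea p v r)
    (vuq : 0 < signedArea v u q) (ruq : 0 < signedArea r u q) (rvq : 0 < signedArea r v q)
    (rvu : 0 < signedArea r v u) : False := by
  obtain ⟨e, he, y₁, hy₁, y₂, hy₂, be, b₁, b₂, cey, cyy, below⟩ :=
    h.below_of_two_inside hp hq hr hu hv cp cq cr cu cv hA pqu pqv pqr puv pur pvr vuq ruq rvq rvu
  have zl := fun a b : ℝ × ℝ => (signedArea_left a b).ge
  have zr := fun a b : ℝ × ℝ => (signedArea_right a b).ge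
  have ne : ∀ {a b x : ℝ × ℝ}, 0 < signedArea a b x → a ≠ b ∧ x ≠ a := by
    intro a b x hpos
    refine ⟨?_, ?_⟩ <;> rintro rfl <;>
      simp [signedArea_self, signedArea_left] at hpos
  have qup := signedArea_pos_rotate pqu
  have upq := signedArea_pos_rotate qup
  have vpq := signedArea_pos_rotate (signedArea_pos_rotate pqv)
  have qrp := signedArea_pos_rotate pqr
  have rpq := signedArea_pos_rotate qrp
  have uvp := signedArea_pos_rotate puv
  have vpu := signedArea_pos_rotate uvp
  have rpu := signedArea_pos_rotate (signedArea_pos_rotate pur)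
  have vrp := signedArea_pos_rotate pvr
  have rpv := signedArea_pos_rotate vrp
  have qru := signedArea_pos_rotate (signedArea_pos_rotate ruq)
  have qrv := signedArea_pos_rotate (signedArea_pos_rotate rvq)
  have puq := signedArea_neg_of_swap upq
  have pvq := signedArea_neg_of_swap vpq
  have upr := signedArea_neg_of_swap pur
  have pvu := signedArea_neg_of_swap vpu
  have vpr := signedArea_neg_of_swap pvr
  have uvq := signedArea_neg_of_swap vuq
  have uvr := signedArea_neg_of_swap (signedArea_pos_rotate rvu)
  obtain ⟨i, hi, bi⟩ := h.exists_blocker p hp q hq (ne pqr).1 (by rw [cp, cq])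
  obtain ⟨f, hf, bf⟩ := h.exists_blocker p hp u hu (ne puv).1 (by rw [cp, cu])
  obtain ⟨g, hg, bg⟩ := h.exists_blocker p hp v hv (ne pvr).1 (by rw [cp, cv])
  obtain ⟨k, hk, bk⟩ := h.exists_blocker p hp r hr (ne pvr).2.symm (by rw [cp, cr])
  -- the triangle `p q r`
  let H : Set (ℝ × ℝ) := {x | 0 ≤ signedArea p q x ∧ 0 ≤ signedArea q r x ∧ 0 ≤ signedArea r p x}
  have hH : ∀ {v w x : ℝ × ℝ}, Sbtw ℝ v x w → v ∈ H → w ∈ H → x ∈ H :=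
    fun hb hv hw => ⟨hb.signedArea_nonneg hv.1 hw.1, hb.signedArea_nonneg hv.2.1 hw.2.1,
      hb.signedArea_nonneg hv.2.2 hw.2.2⟩
  have pH : p ∈ H := ⟨zl _ _, qrp.le, zr _ _⟩
  have qH : q ∈ H := ⟨zr _ _, zl _ _, rpq.le⟩
  have rH : r ∈ H := ⟨pqr.le, zr _ _, zl _ _⟩
  have uH : u ∈ H := ⟨pqu.le, qru.le, rpu.le⟩
  have vH : v ∈ H := ⟨pqv.le, qrv.le, rpv.le⟩
  have iH := hH bi pH qH
  have fH := hH bf pH uH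
  have gH := hH bg pH vH
  have kH := hH bk pH rH
  have eH := hH be uH vH
  have y₁H := hH b₁ uH qH
  have y₂H := hH b₂ rH vH
  have hcol : ∀ {s t x : ℝ × ℝ}, Sbtw ℝ s x t → s ∈ S → t ∈ S → c s = α → x ∈ S → c x ≠ α :=
    fun hb hs ht cs hx hcx => h.color_ne hs hx ht hb (hcx.trans cs.symm)
  have ci := hcol bi hp hq cp hi
  have cf := hcol bf hp hu cp hf
  have cg := hcol bg hp hv cp hg
  have ck := hcol bk hp hr cp hk
  have ce := hcol be hu hv cu he
  have cy₁ := hcol b₁ hu hq cu hy₁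
  -- the part of the triangle on the side of `p`
  let K : Set (ℝ × ℝ) := {x | 0 ≤ signedArea u v x ∧ 0 ≤ signedArea p q x ∧ 0 ≤ signedArea r p x}
  have hU := h.restrict (α := α) (K := K) (fun v hv w hw x hb =>
    ⟨hb.signedArea_nonneg hv.1 hw.1, hb.signedArea_nonneg hv.2.1 hw.2.1,
      hb.signedArea_nonneg hv.2.2 hw.2.2⟩) (by
    rintro x hx hcx hxK
    have := hA x hx hcx
    simp only [List.mem_cons, List.not_mem_nil, or_false] at this
    rcases this with rfl | rfl | rfl | rfl | rfl
    · exact ⟨x, hx, q, hq, (ne pqr).1, cp, cq, signedArea_left _ _, fun y hy => hy.2.1⟩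
    · exact (hxK.1.not_gt uvq).elim
    · exact (hxK.1.not_gt uvr).elim
    · exact ⟨x, hx, v, hv, (ne uvp).1, cu, cv, signedArea_left _ _, fun y hy => hy.1⟩
    · exact ⟨u, hu, x, hx, (ne uvp).1, cu, cv, signedArea_right _ _, fun y hy => hy.1⟩)
  set U : Set (ℝ × ℝ) := {x | x ∈ S ∧ c x ≠ α ∧ x ∈ K} with hUdef
  have hmemU : ∀ {x : ℝ × ℝ}, x ∈ S → c x ≠ α → x ∈ H → (0 ≤ signedArea v u x → False) →
      x ∈ U := fun {x} hx hcx hxH hno =>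
    ⟨hx, hcx, (signedArea_pos_of_neg_swap (not_le.1 hno)).le, hxH.1, hxH.2.2⟩
  have pqi := bi.signedArea_eq_zero_self
  have upf := bf.symm.signedArea_eq_zero_self
  have puf := bf.signedArea_eq_zero_self
  have vpg := bg.symm.signedArea_eq_zero_self
  have pvg := bg.signedArea_eq_zero_self
  have rpk := bk.symm.signedArea_eq_zero_self
  have uve := be.signedArea_eq_zero_self
  have quy₁ := b₁.symm.signedArea_eq_zero_self
  have vry₂ := b₂.symm.signedArea_eq_zero_self
  have pqf := bf.signedArea_pos_of_right (zl p q) pqu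
  have pqy₁ := b₁.signedArea_pos_of_left pqu (zr p q)
  have upi := bi.signedArea_pos_of_right (zr u p) upq
  have upy₁ := b₁.signedArea_pos_of_right (zl u p) upq
  have vpi := bi.signedArea_pos_of_right (zr v p) vpq
  have vpf := bf.signedArea_pos_of_right (zr v p) vpu
  have vpy₁ := b₁.signedArea_pos_of_left vpu vpq.le
  have vpe := be.signedArea_pos_of_left vpu (zl v p)
  have qui := bi.signedArea_pos_of_left qup (zl q u)
  have quf := bf.signedArea_pos_of_left qup (zr q u)
  have pug := bg.signedArea_pos_of_right (zl p u) puv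
  have pue := be.signedArea_pos_of_right (zr p u) puv
  have puk := bk.signedArea_pos_of_right (zl p u) pur
  have puy₂ := b₂.signedArea_pos_of_left pur puv.le
  have uvf := bf.signedArea_pos_of_left uvp (zl u v)
  have uvg := bg.signedArea_pos_of_left uvp (zr u v)
  have pvk := bk.signedArea_pos_of_right (zl p v) pvr
  have pvy₂ := b₂.signedArea_pos_of_left pvr (zr p v)
  have rpg := bg.signedArea_pos_of_right (zr r p) rpv
  have rpy₂ := b₂.signedArea_pos_of_right (zl r p) rpv
  have vrg := bg.signedArea_pos_of_left vrp (zl v r)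
  have vrk := bk.signedArea_pos_of_left vrp (zr v r)
  have upe := signedArea_neg_of_swap pue
  have pui := signedArea_neg_of_swap upi
  have vpk := signedArea_neg_of_swap pvk
  have pve := signedArea_neg_of_swap vpe
  have hnd : [e, f, g, i, k].Nodup := by
    simp only [List.nodup_cons, List.mem_cons, List.not_mem_nil, or_false, not_or,
      not_false_eq_true, List.nodup_nil, and_true]
    refine ⟨⟨?_, ?_, ?_, ?_⟩, ⟨?_, ?_, ?_⟩, ⟨?_, ?_⟩, ?_⟩ <;> rintro rfl <;> linarith
  have hmem : ∀ x ∈ [e, f, g, i, k], x ∈ U := by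
    intro x hx
    simp only [List.mem_cons, List.not_mem_nil, or_false] at hx
    rcases hx with rfl | rfl | rfl | rfl | rfl
    · exact ⟨he, ce, uve.ge, eH.1, eH.2.2⟩
    · exact ⟨hf, cf, uvf.le, fH.1, fH.2.2⟩
    · exact ⟨hg, cg, uvg.le, gH.1, gH.2.2⟩
    · exact hmemU hi ci iH fun hc => (below x hi ci hc iH.1 iH.2.1 iH.2.2).1.ne' pqi
    · exact hmemU hk ck kH fun hc => (below x hk ck hc kH.1 kH.2.1 kH.2.2).2.1.ne' rpk
  let I₁ : Set (ℝ × ℝ) := {x | 0 < signedArea p q x ∧ 0 < signedArea u p x ∧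
    0 < signedArea v p x ∧ 0 < signedArea q u x}
  let I₂ : Set (ℝ × ℝ) := {x | 0 < signedArea p u x ∧ 0 < signedArea v p x ∧ 0 < signedArea u v x}
  let I₃ : Set (ℝ × ℝ) := {x | 0 < signedArea p v x ∧ 0 < signedArea p u x ∧
    0 < signedArea r p x ∧ 0 < signedArea v r x}
  have three : ∀ {P : ℝ × ℝ → Prop} {x y z : ℝ × ℝ}, P x → P y → P z → ∀ t ∈ [x, y, z], P t := by
    intro P x y z px py pz t ht
    simp only [List.mem_cons, List.not_mem_nil, or_false] at ht
    rcases ht with rfl | rfl | rfl <;> assumption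
  have hopp : ∀ {a b x : ℝ × ℝ}, 0 < signedArea a b x → 0 < signedArea b a x → False :=
    fun h1 h2 => (signedArea_neg_of_swap h2).not_gt h1
  refine h.three_triangles (I₁ := I₁) (I₂ := I₂) (I₃ := I₃) hU (fun x hx => hx.1)
    (fun x hx => hx.2.1) hnd hmem hy₁ hy₂ cy₁ cyy cey ?_ ?_ ?_ ?_ (fun z h1 h2 => hopp h1.2.1 h2.1)
    (fun z h1 h3 => hopp h1.2.1 h3.2.1) (fun z h2 h3 => hopp h2.2.1 h3.1) ?_ ?_ ?_ ?_ ?_ ?_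
  · rintro rfl; linarith
  · rintro rfl; linarith
  · rintro rfl; linarith
  · rintro rfl; linarith
  · rintro z ⟨z1, z2, z3, z4⟩ hz
    simp only [List.mem_cons, List.not_mem_nil, or_false] at hz
    rcases hz with rfl | rfl | rfl | rfl | rfl <;> linarith
  · rintro z ⟨z1, z2, z3⟩ hz
    simp only [List.mem_cons, List.not_mem_nil, or_false] at hz
    rcases hz with rfl | rfl | rfl | rfl | rfl <;> linarith
  · rintro z ⟨z1, z2, z3, z4⟩ hz
    simp only [List.mem_cons, List.not_mem_nil, or_false] at hz
    rcases hz with rfl | rfl | rfl | rfl | rfl <;> linarith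
  · intro s hs t ht hst hc
    obtain ⟨z, hz, hb⟩ := h.exists_blocker s (three (P := (· ∈ S)) hi hf hy₁ s hs) t
      (three (P := (· ∈ S)) hi hf hy₁ t ht) hst hc
    have zH := hH hb (three (P := (· ∈ H)) iH fH y₁H s hs) (three (P := (· ∈ H)) iH fH y₁H t ht)
    have z1 := hb.signedArea_pos_of_list pqi.ge
      (three (.inl rfl) (.inr pqf) (.inr pqy₁)) hs ht
    have z2 := hb.signedArea_pos_of_list upf.ge
      (three (.inr upi) (.inl rfl) (.inr upy₁)) hs ht
    have z3 := hb.signedArea_pos_of_list vpi.le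
      (three (.inr vpi) (.inr vpf) (.inr vpy₁)) hs ht
    have z4 := hb.signedArea_pos_of_list quy₁.ge
      (three (.inr qui) (.inr quf) (.inl rfl)) hs ht
    have cz : c z ≠ α := by
      intro hcz
      have := hA z hz hcz
      simp only [List.mem_cons, List.not_mem_nil, or_false] at this
      rcases this with rfl | rfl | rfl | rfl | rfl
      · exact z1.ne' (signedArea_left _ _)
      · exact z1.ne' (signedArea_right _ _)
      · exact z2.not_gt upr
      · exact z2.ne' (signedArea_left _ _)
      · exact z3.ne' (signedArea_left _ _)
    exact ⟨z, ⟨hmemU hz cz zH fun hc => (below z hz cz hc zH.1 zH.2.1 zH.2.2).2.2.1.not_gt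
      (signedArea_neg_of_swap z4), z1, z2, z3, z4⟩, hb⟩
  · intro s hs t ht hst hc
    obtain ⟨z, hz, hb⟩ := h.exists_blocker s (three (P := (· ∈ S)) hf hg he s hs) t
      (three (P := (· ∈ S)) hf hg he t ht) hst hc
    have zH := hH hb (three (P := (· ∈ H)) fH gH eH s hs) (three (P := (· ∈ H)) fH gH eH t ht)
    have z1 := hb.signedArea_pos_of_list puf.ge
      (three (.inl rfl) (.inr pug) (.inr pue)) hs ht
    have z2 := hb.signedArea_pos_of_list vpg.ge
      (three (.inr vpf) (.inl rfl) (.inr vpe)) hs ht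
    have z3 := hb.signedArea_pos_of_list uve.ge
      (three (.inr uvf) (.inr uvg) (.inl rfl)) hs ht
    have cz : c z ≠ α := by
      intro hcz
      have := hA z hz hcz
      simp only [List.mem_cons, List.not_mem_nil, or_false] at this
      rcases this with rfl | rfl | rfl | rfl | rfl
      · exact z1.ne' (signedArea_left _ _)
      · exact z1.not_gt puq
      · exact z2.not_gt vpr
      · exact z1.ne' (signedArea_right _ _)
      · exact z2.ne' (signedArea_left _ _)
    exact ⟨z, ⟨⟨hz, cz, z3.le, zH.1, zH.2.2⟩, z1, z2, z3⟩, hb⟩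
  · intro s hs t ht hst hc
    obtain ⟨z, hz, hb⟩ := h.exists_blocker s (three (P := (· ∈ S)) hg hk hy₂ s hs) t
      (three (P := (· ∈ S)) hg hk hy₂ t ht) hst hc
    have zH := hH hb (three (P := (· ∈ H)) gH kH y₂H s hs) (three (P := (· ∈ H)) gH kH y₂H t ht)
    have z1 := hb.signedArea_pos_of_list pvg.ge
      (three (.inl rfl) (.inr pvk) (.inr pvy₂)) hs ht
    have z2 := hb.signedArea_pos_of_list pug.le
      (three (.inr pug) (.inr puk) (.inr puy₂)) hs ht
    have z3 := hb.signedArea_pos_of_list rpk.ge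
      (three (.inr rpg) (.inl rfl) (.inr rpy₂)) hs ht
    have z4 := hb.signedArea_pos_of_list vry₂.ge
      (three (.inr vrg) (.inr vrk) (.inl rfl)) hs ht
    have cz : c z ≠ α := by
      intro hcz
      have := hA z hz hcz
      simp only [List.mem_cons, List.not_mem_nil, or_false] at this
      rcases this with rfl | rfl | rfl | rfl | rfl
      · exact z2.ne' (signedArea_left _ _)
      · exact z1.not_gt pvq
      · exact z3.ne' (signedArea_left _ _)
      · exact z1.not_gt pvu
      · exact z1.ne' (signedArea_right _ _)
    exact ⟨z, ⟨hmemU hz cz zH fun hc => (below z hz cz hc zH.1 zH.2.1 zH.2.2).2.2.2.not_gt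
      (signedArea_neg_of_swap z4), z1, z2, z3, z4⟩, hb⟩

end TwoInside

end BlockedConfig

theorem signedArea_perm_pos {a b x : ℝ × ℝ} (h : 0 < signedArea a b x) :
    0 < signedArea b x a ∧ 0 < signedArea x a b ∧ signedArea b a x < 0 ∧ signedArea a x b < 0 ∧
      signedArea x b a < 0 :=
  have h' := signedArea_pos_rotate h
  have h'' := signedArea_pos_rotate h'
  ⟨h', h'', signedArea_neg_of_swap h, signedArea_neg_of_swap h'', signedArea_neg_of_swap h'⟩

theorem signedArea_perm_neg {a b x : ℝ × ℝ} (h : signedArea a b x < 0) :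
    0 < signedArea b a x ∧ 0 < signedArea a x b ∧ 0 < signedArea x b a :=
  have h' := signedArea_pos_of_neg_swap h
  ⟨h', signedArea_pos_rotate h', signedArea_pos_rotate (signedArea_pos_rotate h')⟩

namespace BlockedConfig

section FivePoints

variable {c : ℝ × ℝ → Fin 4} {S : Set (ℝ × ℝ)} {α : Fin 4} {o a b d e : ℝ × ℝ}

/-- A four-coloured blocked configuration cannot have exactly five points of a colour `α`; here
these are `o` and further points `a`, `b`, `d`, `e` sorted by angle around `o`. -/
theorem not_five_sorted (h : BlockedConfig c S)
    (ho : o ∈ S) (ha : a ∈ S) (hb : b ∈ S) (hd : d ∈ S) (he : e ∈ S)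
    (co : c o = α) (ca : c a = α) (cb : c b = α) (cd : c d = α) (ce : c e = α)
    (hA : ∀ x ∈ S, c x = α → x ∈ [o, a, b, d, e])
    (oab : 0 < signedArea o a b) (oad : 0 < signedArea o a d) (oae : 0 < signedArea o a e)
    (obd : 0 < signedArea o b d) (obe : 0 < signedArea o b e) (ode : 0 < signedArea o d e) :
    False := by
  have hne : ∀ {p q x : ℝ × ℝ}, 0 < signedArea p q x → p ≠ q ∧ q ≠ x := by
    intro p q x hpos
    refine ⟨?_, ?_⟩ <;> rintro rfl <;> simp [signedArea_self, signedArea_right] at hpos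
  have poab := signedArea_perm_pos oab
  have poad := signedArea_perm_pos oad
  have poae := signedArea_perm_pos oae
  have pobd := signedArea_perm_pos obd
  have pobe := signedArea_perm_pos obe
  have pode := signedArea_perm_pos ode
  have oa := (hne oab).1
  have ob := (hne obd).1
  have od := (hne ode).1
  have oe : o ≠ e := (hne pode.2.1).1.symm
  have ab := (hne oab).2
  have ad := (hne oad).2
  have ae := (hne oae).2
  have bd := (hne obd).2
  have be := (hne obe).2
  have de := (hne ode).2
  have hsign : ∀ {p q x : ℝ × ℝ}, p ∈ S → q ∈ S → x ∈ S → c p = α → c q = α → c x = α →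
      p ≠ q → p ≠ x → q ≠ x → 0 < signedArea p q x ∨ signedArea p q x < 0 :=
    fun hp hq hx cp cq cx pq px qx =>
      (lt_or_gt_of_ne (h.signedArea_ne_zero hp hq hx pq px qx (cp.trans cq.symm)
        (cp.trans cx.symm))).symm
  have hblock : ∀ {p q : ℝ × ℝ}, p ∈ S → q ∈ S → c p = α → c q = α → p ≠ q →
      ∃ x ∈ S, Sbtw ℝ p x q :=
    fun hp hq cp cq pq => h.exists_blocker _ hp _ hq pq (cp.trans cq.symm)
  obtain ⟨moa, hoa, soa⟩ := hblock ho ha co ca oa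
  obtain ⟨mob, hob, sob⟩ := hblock ho hb co cb ob
  obtain ⟨mod, hod, sod⟩ := hblock ho hd co cd od
  obtain ⟨moe, hoe, soe⟩ := hblock ho he co ce oe
  obtain ⟨mab, hab, sab⟩ := hblock ha hb ca cb ab
  obtain ⟨mad, had, sad⟩ := hblock ha hd ca cd ad
  obtain ⟨mae, hae, sae⟩ := hblock ha he ca ce ae
  obtain ⟨mbd, hbd, sbd⟩ := hblock hb hd cb cd bd
  obtain ⟨mbe, hbe, sbe⟩ := hblock hb he cb ce be
  obtain ⟨mde, hde, sde⟩ := hblock hd he cd ce de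
  have hA' := hA
  have hsub : ∀ {l : List (ℝ × ℝ)} {x : ℝ × ℝ}, [o, a, b, d, e] ⊆ l → x ∈ [o, a, b, d, e] → x ∈ l :=
    fun hl hx => hl hx
  simp only [List.mem_cons, List.not_mem_nil, or_false] at hA
  have quad_oabd (abd : 0 < signedArea a b d) :=
    h.quadrilateral ho ha hb hd co ca cb cd oab oad abd obd (by
      intro x hx hcx _ _ _ h4
      rcases hA x hx hcx with k | k | k | k | rfl
      iterate 4 simp [k]
      exact (h4.not_gt pode.2.2.1).elim)
      hoa hab hbd hod hob had soa sab sbd sod.symm sob sad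
  have quad_obde (sde' : 0 < signedArea b d e) :=
    h.quadrilateral ho hb hd he co cb cd ce obd obe sde' ode (by
      intro x hx hcx h1 _ _ _
      rcases hA x hx hcx with k | rfl | k | k | k
      · simp [k]
      · exact (h1.not_gt poab.2.2.2.1).elim
      all_goals simp [k])
      hob hbd hde hoe hod hbe sob sbd sde soe.symm sod sbe
  have i₁ : signedArea o a b * signedArea a d e - signedArea o a d * signedArea a b e +
      signedArea o a e * signedArea a b d = 0 := by unfold signedArea; ring
  have i₂ : signedArea o a e * signedArea b d e - signedArea o b e * signedArea a d e +
      signedArea o d e * signedArea a b e = 0 := by unfold signedArea; ring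
  have i₃ : signedArea o a b * signedArea b d e - signedArea o b d * signedArea a b e +
      signedArea o b e * signedArea a b d = 0 := by unfold signedArea; ring
  have not_convex_oade (abd : 0 < signedArea a b d) (ade : 0 < signedArea a d e) : False := by
    obtain ⟨e₁, -, k₁, -⟩ := quad_oabd abd
    obtain ⟨e₂, -, k₂, -⟩ := h.quadrilateral ho ha hd he co ca cd ce oad oae ade ode (by
      intro x hx hcx _ h2 _ _
      rcases hA x hx hcx with k | k | rfl | k | k
      iterate 2 simp [k]
      · exact (h2.not_gt (signedArea_perm_pos abd).2.2.2.1).elim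
      all_goals simp [k])
      hoa had hde hoe hod hae soa sad sde soe.symm sod sae
    rw [e₁] at k₁
    exact h.no_four mab hab mad had mod hod moe hoe k₁ k₂
  have not_convex_oabe (abe : 0 < signedArea a b e) (bde : 0 < signedArea b d e) : False := by
    obtain ⟨e₁, k₁, -⟩ := quad_obde bde
    obtain ⟨-, k₂, -⟩ := h.quadrilateral ho ha hb he co ca cb ce oab oae abe obe (by
      intro x hx hcx _ _ h3 _
      rcases hA x hx hcx with k | k | k | rfl | k
      iterate 3 simp [k]
      · exact (h3.not_gt (signedArea_perm_pos bde).2.2.2.1).elim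
      · simp [k])
      hoa hab hbe hoe hob hae soa sab sbe soe.symm sob sae
    rw [e₁] at k₁
    exact h.no_four moa hoa mob hob mbe hbe mde hde k₂ k₁
  rcases hsign ha hb hd ca cb cd ab ad bd with abd | abd <;>
    rcases hsign ha hd he ca cd ce ad ae de with ade | ade
  · exact not_convex_oade abd ade
  all_goals
    rcases hsign ha hb he ca cb ce ab ae be with abe | abe <;>
    rcases hsign hb hd he cb cd ce bd be de with bde | bde
  · exact not_convex_oabe abe bde
  · obtain ⟨e₁, k₁, -⟩ := quad_oabd abd
    obtain ⟨e₂, -, k₂, -⟩ := h.quadrilateral ha hb he hd ca cb ce cd abe abd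
      (signedArea_perm_neg bde).2.1 (signedArea_perm_neg ade).2.1 (by
      intro x hx hcx _ _ _ h4
      rcases hA x hx hcx with rfl | k | k | k | k
      · exact (h4.not_gt poad.2.2.2.2).elim
      all_goals simp [k])
      hab hbe hde had hae hbd sab sbe sde.symm sad.symm sae sbd
    rw [e₁] at k₁
    rw [e₂] at k₂
    exact h.no_four moa hoa mad had mbd hbd mbe hbe k₁ k₂.symm
  · linarith [mul_pos oab bde, mul_neg_of_pos_of_neg obd abe, mul_pos obe abd]
  · exact h.not_two_inside he ho ha hd hb ce co ca cd cb
      (fun x hx hcx => hsub (by simp) (hA' x hx hcx))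
      pode.2.1 pobe.2.1 poae.2.1 (signedArea_perm_neg bde).2.2 (signedArea_perm_neg ade).2.2
      (signedArea_perm_neg abe).2.2 pobd.1 poad.1 poab.1 abd
  · exact not_convex_oabe abe bde
  · linarith [mul_neg_of_pos_of_neg oab bde, mul_pos obd abe, mul_neg_of_pos_of_neg obe abd]
  · obtain ⟨e₁, -, k₁, -⟩ := quad_obde bde
    obtain ⟨e₂, -, k₂, -⟩ := h.quadrilateral hb ha hd he cb ca cd ce
      (signedArea_perm_neg abd).1 (signedArea_perm_neg abe).1 ade bde (by
      intro x hx hcx _ _ _ h4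
      rcases hA x hx hcx with rfl | k | k | k | k
      · exact (h4.not_gt pobe.2.2.2.2).elim
      all_goals simp [k])
      hab had hde hbe hbd hae sab.symm sad sde sbe.symm sbd sae
    rw [e₁] at k₁
    exact h.no_four mad had mbd hbd mbe hbe moe hoe k₂ k₁
  · linarith [mul_neg_of_pos_of_neg oae bde, mul_pos obe ade, mul_neg_of_pos_of_neg ode abe]
  · exact not_convex_oabe abe bde
  · linarith [mul_neg_of_pos_of_neg oab ade, mul_pos oad abe, mul_neg_of_pos_of_neg oae abd]
  · exact h.not_two_inside ha he ho hd hb ca ce co cd cb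
      (fun x hx hcx => hsub (by simp) (hA' x hx hcx))
      (signedArea_perm_neg ade).2.1 (signedArea_perm_neg abe).2.1 poae.1
      (signedArea_perm_neg abd).2.1 poad.1 poab.1 bde ode obe obd
  · exact h.not_two_inside ho ha he hb hd co ca ce cb cd
      (fun x hx hcx => hsub (by simp) (hA' x hx hcx))
      oab oad oae obd obe ode (signedArea_perm_neg abd).2.2 (signedArea_perm_neg abe).2.2
      (signedArea_perm_neg ade).2.2 (signedArea_perm_neg bde).2.2

end FivePoints

end BlockedConfig

namespace BlockedConfig

section Reduction

variable {κ : Type*} {c : ℝ × ℝ → κ} {α : κ}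

/-- A blocked configuration contains a blocked configuration with one point fewer of colour `α`. -/
theorem exists_sub_erase {S : Set (ℝ × ℝ)} (h : BlockedConfig c S)
    (hne : (S ∩ c ⁻¹' {α}).Nonempty) :
    ∃ T, BlockedConfig c T ∧ (T ∩ c ⁻¹' {α}).ncard = (S ∩ c ⁻¹' {α}).ncard - 1 := by
  set A := S ∩ c ⁻¹' {α} with hAdef
  have hA : A.Finite := h.finite.subset Set.inter_subset_left
  obtain ⟨a, ha⟩ := (hA.isCompact_convexHull ℝ).extremePoints_nonempty hne.convexHull
  have haA : a ∈ A := extremePoints_convexHull_subset ha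
  have hconv := ((convex_convexHull ℝ A).mem_extremePoints_iff_convex_sdiff.1 ha).2
  refine ⟨S ∩ (convexHull ℝ A \ {a}), h.mono Set.inter_subset_left ?_, ?_⟩
  · rintro v ⟨-, hv⟩ w ⟨-, hw⟩ - - x hx hb
    exact ⟨hx, hconv.mem_of_wbtw hb.wbtw hv hw⟩
  · rw [← Set.ncard_sdiff_singleton_of_mem haA]
    congr 1
    ext x
    constructor
    · rintro ⟨⟨hx, -, hxa⟩, hcx⟩
      exact ⟨⟨hx, hcx⟩, hxa⟩
    · rintro ⟨⟨hx, hcx⟩, hxa⟩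
      exact ⟨⟨hx, subset_convexHull ℝ A ⟨hx, hcx⟩, hxa⟩, hcx⟩

theorem exists_ncard_eq {S : Set (ℝ × ℝ)} (h : BlockedConfig c S) {n : ℕ}
    (hn : n ≤ (S ∩ c ⁻¹' {α}).ncard) :
    ∃ T, BlockedConfig c T ∧ (T ∩ c ⁻¹' {α}).ncard = n := by
  induction hn using Nat.decreasingInduction with
  | self => exact ⟨S, h, rfl⟩
  | of_succ k _ ih =>
    obtain ⟨T, hT, hcard⟩ := ih
    obtain ⟨T', hT', hcard'⟩ := hT.exists_sub_erase
      (Set.nonempty_of_ncard_ne_zero (by rw [hcard]; exact k.succ_ne_zero))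
    exact ⟨T', hT', by rw [hcard', hcard, Nat.add_sub_cancel]⟩

end Reduction

end BlockedConfig

/-- Points in general position in a half-plane bounded by a line through `o` have a first point
in the order by angle around `o`. -/
theorem exists_first_around {o : ℝ × ℝ} (B : Finset (ℝ × ℝ)) (hB : B.Nonempty)
    (hlex : ∀ x ∈ B, o.1 < x.1 ∨ o.1 = x.1 ∧ o.2 < x.2)
    (hgen : ∀ x ∈ B, ∀ y ∈ B, x ≠ y → signedArea o x y ≠ 0) :
    ∃ x ∈ B, ∀ y ∈ B, y ≠ x → 0 < signedArea o x y := by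
  induction hB using Finset.Nonempty.cons_induction with
  | singleton a => exact ⟨a, by simp, by simp⟩
  | cons a B ha hB ih =>
    obtain ⟨m, hm, hmin⟩ := ih (fun x hx => hlex x (Finset.mem_cons_of_mem hx))
      (fun x hx y hy => hgen x (Finset.mem_cons_of_mem hx) y (Finset.mem_cons_of_mem hy))
    have hma : m ≠ a := fun e => ha (e ▸ hm)
    have hmB : m ∈ Finset.cons a B ha := Finset.mem_cons_of_mem hm
    have haB : a ∈ Finset.cons a B ha := Finset.mem_cons_self a B
    rcases lt_or_gt_of_ne (hgen m hmB a haB hma) with hlt | hgt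
    · have ham : 0 < signedArea o a m := by unfold signedArea at hlt ⊢; linarith
      refine ⟨a, haB, fun y hy hya => ?_⟩
      have hyB : y ∈ B := (Finset.mem_cons.1 hy).resolve_left hya
      by_cases hym : y = m
      · rwa [hym]
      have hmy := hmin y hyB hym
      refine lt_of_le_of_ne ?_ (hgen a haB y hy (Ne.symm hya)).symm
      have hay : (m.1 - o.1) * signedArea o a y =
          (a.1 - o.1) * signedArea o m y + (y.1 - o.1) * signedArea o a m := by
        unfold signedArea; ring
      have ha' : 0 ≤ a.1 - o.1 := by rcases hlex a haB with h | h <;> linarith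
      have hy' : 0 ≤ y.1 - o.1 := by rcases hlex y hy with h | h <;> linarith
      rcases hlex m hmB with h | ⟨h1, h2⟩
      · refine nonneg_of_mul_nonneg_right ?_ (sub_pos.2 h)
        rw [hay]
        positivity
      · exfalso
        unfold signedArea at hmy
        have h0 : m.1 - o.1 = 0 := by linarith
        rw [h0, zero_mul] at hmy
        linarith [mul_nonneg (sub_pos.2 h2).le hy']
    · refine ⟨m, hmB, fun y hy hym => ?_⟩
      rcases Finset.mem_cons.1 hy with rfl | hy
      · exact hgt
      · exact hmin y hy hym

/-- In a four-coloured blocked configuration, no colour is used exactly five times. -/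
theorem BlockedConfig.ncard_ne_five {c : ℝ × ℝ → Fin 4} {S : Set (ℝ × ℝ)}
    (h : BlockedConfig c S) (α : Fin 4) : (S ∩ c ⁻¹' {α}).ncard ≠ 5 := by
  intro hcard
  have hfin : (S ∩ c ⁻¹' {α}).Finite := h.finite.subset Set.inter_subset_left
  obtain ⟨A, hA⟩ := hfin.exists_finset_coe
  rw [← hA, Set.ncard_coe_finset] at hcard
  have memA : ∀ x, x ∈ A ↔ x ∈ S ∧ c x = α := fun x => by
    rw [← Finset.mem_coe, hA]; rfl
  obtain ⟨o, ho, hmin⟩ := A.exists_min_image (fun x => toLex x)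
    (Finset.card_pos.1 (by rw [hcard]; norm_num))
  have hlex : ∀ x ∈ A.erase o, o.1 < x.1 ∨ o.1 = x.1 ∧ o.2 < x.2 := by
    intro x hx
    obtain ⟨hxo, hxA⟩ := Finset.mem_erase.1 hx
    have hlt : toLex o < toLex x :=
      lt_of_le_of_ne (hmin x hxA) fun e => hxo (toLex.injective e).symm
    exact Prod.Lex.toLex_lt_toLex.1 hlt
  have hgen : ∀ x ∈ A.erase o, ∀ y ∈ A.erase o, x ≠ y → signedArea o x y ≠ 0 := by
    intro x hx y hy hxy
    obtain ⟨hxo, hxA⟩ := Finset.mem_erase.1 hx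
    obtain ⟨hyo, hyA⟩ := Finset.mem_erase.1 hy
    rw [memA] at ho hxA hyA
    exact h.signedArea_ne_zero ho.1 hxA.1 hyA.1 hxo.symm hyo.symm hxy (ho.2.trans hxA.2.symm)
      (ho.2.trans hyA.2.symm)
  have first : ∀ B ⊆ A.erase o, 0 < B.card → ∃ x ∈ B, ∀ y ∈ B, y ≠ x → 0 < signedArea o x y :=
    fun B hB hpos => exists_first_around B (Finset.card_pos.1 hpos) (fun x hx => hlex x (hB hx))
      fun x hx y hy => hgen x (hB hx) y (hB hy)
  have card₁ : (A.erase o).card = 4 := by rw [Finset.card_erase_of_mem ho, hcard]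
  obtain ⟨a, ha, hamin⟩ := first _ subset_rfl (by omega)
  have card₂ := Finset.card_erase_of_mem ha
  have sub₂ := Finset.erase_subset a (A.erase o)
  obtain ⟨b, hb, hbmin⟩ := first _ sub₂ (by omega)
  have card₃ := Finset.card_erase_of_mem hb
  have sub₃ := (Finset.erase_subset b _).trans sub₂
  obtain ⟨d, hd, hdmin⟩ := first _ sub₃ (by omega)
  have card₄ := Finset.card_erase_of_mem hd
  obtain ⟨e, he⟩ := Finset.card_eq_one.1
    (by omega : ((((A.erase o).erase a).erase b).erase d).card = 1)
  have hall : ∀ x, x ∈ A → x ∈ [o, a, b, d, e] := by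
    intro x hx
    by_contra hn
    simp only [List.mem_cons, List.not_mem_nil, or_false, not_or] at hn
    obtain ⟨xo, xa, xb, xd, xe⟩ := hn
    refine xe (Finset.mem_singleton.1 (he ▸ ?_))
    simp only [Finset.mem_erase]
    exact ⟨xd, xb, xa, xo, hx⟩
  have he' : e ∈ (((A.erase o).erase a).erase b).erase d := he ▸ Finset.mem_singleton_self e
  simp only [Finset.mem_erase] at ha hb hd he'
  obtain ⟨ed, eb, ea, eo, eA⟩ := he'
  obtain ⟨db, da, d_o, dA⟩ := hd
  obtain ⟨ba, bo, bA⟩ := hb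
  obtain ⟨ao, aA⟩ := ha
  have ho' := (memA o).1 ho
  have ha' := (memA a).1 aA
  have hb' := (memA b).1 bA
  have hd' := (memA d).1 dA
  have he' := (memA e).1 eA
  exact h.not_five_sorted ho'.1 ha'.1 hb'.1 hd'.1 he'.1 ho'.2 ha'.2 hb'.2 hd'.2 he'.2
    (fun x hx hcx => hall x ((memA x).2 ⟨hx, hcx⟩))
    (hamin b (by simp [*]) ba) (hamin d (by simp [*]) da) (hamin e (by simp [*]) ea)
    (hbmin d (by simp [*]) db) (hbmin e (by simp [*]) eb) (hdmin e (by simp [*]) ed)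

/-- Each colour class in a 4-blocked point set has at most four points. -/
theorem colour_class_le_four (P : Set (ℝ × ℝ)) (hfin : P.Finite)
    (c : (ℝ × ℝ) → Fin 4) (hc : BlockedColouring P c) (i : Fin 4) :
    (P ∩ c ⁻¹' {i}).ncard ≤ 4 := by
  by_contra! hlt
  obtain ⟨T, hT, hcard⟩ := (hc.blockedConfig hfin).exists_ncard_eq (α := i) (n := 5) hlt
  exact hT.ncard_ne_five i hcard
end

section
/- Let P ⊆ ℝ² be an {n₁,…,n_k}-midpoint-blocked point set and Q ⊆ ℝ² an {m₁,…,m_ℓ}-midpoint-blocked point set. Let P × Q ⊆ ℝ⁴ be the set {(x_v, y_v, x_w, y_w) : v = (x_v,y_v) ∈ P, w = (x_w,y_w) ∈ Q}, with the point corresponding to (v,w) coloured by the ordered pair (colour of v in P, colour of w in Q). Then P × Q is {nᵢ·mⱼ : i ∈ [k], j ∈ [ℓ]}-midpoint-blocked (as a point set in ℝ⁴, with blocking defined via open segments in ℝ⁴). -/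
/-- The product colouring: a point of `E × F` is coloured by the pair of colours of its
components. -/
def prodColouring {E F : Type*} {k l : ℕ} (c : E → Fin k) (d : F → Fin l) :
    E × F → Fin (k * l) :=
  fun p => finProdFinEquiv (c p.1, d p.2)

theorem prodColouring_eq_iff {E F : Type*} {k l : ℕ} {c : E → Fin k} {d : F → Fin l}
    {p q : E × F} :
    prodColouring c d p = prodColouring c d q ↔ c p.1 = c q.1 ∧ d p.2 = d q.2 := by
  simp [prodColouring, -finProdFinEquiv_apply_val]

theorem inter_preimage_prodColouring {E F : Type*} {k l : ℕ} (P : Set E) (Q : Set F)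
    (c : E → Fin k) (d : F → Fin l) (i : Fin k) (j : Fin l) :
    (P ×ˢ Q) ∩ prodColouring c d ⁻¹' {finProdFinEquiv (i, j)} =
      (P ∩ c ⁻¹' {i}) ×ˢ (Q ∩ d ⁻¹' {j}) := by
  ext p
  simp only [prodColouring, Set.mem_inter_iff, Set.mem_prod, Set.mem_preimage,
    Set.mem_singleton_iff, EmbeddingLike.apply_eq_iff_eq, Prod.mk.injEq]
  tauto

section Product

variable {E F : Type*} [AddCommGroup E] [Module ℝ E] [AddCommGroup F] [Module ℝ F]

theorem Blocks.fst {x v w : E × F} (h : Blocks x v w) : Blocks x.1 v.1 w.1 := by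
  obtain ⟨a, b, ha, hb, hab, rfl⟩ := h
  exact ⟨a, b, ha, hb, hab, rfl⟩

theorem Blocks.snd {x v w : E × F} (h : Blocks x v w) : Blocks x.2 v.2 w.2 := by
  obtain ⟨a, b, ha, hb, hab, rfl⟩ := h
  exact ⟨a, b, ha, hb, hab, rfl⟩

theorem midpoint_mem_of_colour_eq {k : ℕ} {P : Set E} {c : E → Fin k}
    (h : ∀ v ∈ P, ∀ w ∈ P, v ≠ w → c v = c w → midpoint ℝ v w ∈ P)
    {v w : E} (hv : v ∈ P) (hw : w ∈ P) (hc : c v = c w) : midpoint ℝ v w ∈ P := by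
  by_cases hvw : v = w
  · simpa [hvw] using hw
  · exact h v hv w hw hvw hc

theorem midpoint_mem_prod {k l : ℕ} {P : Set E} {Q : Set F} {c : E → Fin k} {d : F → Fin l}
    (hP : ∀ v ∈ P, ∀ w ∈ P, v ≠ w → c v = c w → midpoint ℝ v w ∈ P)
    (hQ : ∀ v ∈ Q, ∀ w ∈ Q, v ≠ w → d v = d w → midpoint ℝ v w ∈ Q)
    {v w : E × F} (hv : v ∈ P ×ˢ Q) (hw : w ∈ P ×ˢ Q)
    (h : prodColouring c d v = prodColouring c d w) : midpoint ℝ v w ∈ P ×ˢ Q :=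
  have h := prodColouring_eq_iff.1 h
  ⟨midpoint_mem_of_colour_eq hP hv.1 hw.1 h.1, midpoint_mem_of_colour_eq hQ hv.2 hw.2 h.2⟩

theorem BlockedColouring.visible {k : ℕ} {P : Set E} {c : E → Fin k}
    (h : BlockedColouring P c) {v w : E} (hv : v ∈ P) (hw : w ∈ P) (hc : c v ≠ c w) :
    Visible P v w :=
  (h v hv w hw (ne_of_apply_ne c hc)).2 hc

theorem BlockedColouring.prod {k l : ℕ} {P : Set E} {Q : Set F} {c : E → Fin k}
    {d : F → Fin l} (hc : BlockedColouring P c) (hd : BlockedColouring Q d)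
    (hP : ∀ v ∈ P, ∀ w ∈ P, v ≠ w → c v = c w → midpoint ℝ v w ∈ P)
    (hQ : ∀ v ∈ Q, ∀ w ∈ Q, v ≠ w → d v = d w → midpoint ℝ v w ∈ Q) :
    BlockedColouring (P ×ˢ Q) (prodColouring c d) := by
  intro v hv w hw _
  constructor
  · intro hvis h
    exact hvis _ (midpoint_mem_prod hP hQ hv hw h) (midpoint_mem_openSegment v w)
  · intro h x hx hb
    rw [Ne, prodColouring_eq_iff, not_and_or] at h
    rcases h with h | h
    · exact hc.visible hv.1 hw.1 h x.1 hx.1 hb.fst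
    · exact hd.visible hv.2 hw.2 h x.2 hx.2 hb.snd

end Product

theorem map_univ_prodColouring_ncard {E F : Type*} {k l : ℕ} (P : Set E) (Q : Set F)
    (c : E → Fin k) (d : F → Fin l) :
    Finset.univ.val.map
        (fun i : Fin (k * l) => ((P ×ˢ Q) ∩ prodColouring c d ⁻¹' {i}).ncard) =
      (Finset.univ.val.map fun i : Fin k => (P ∩ c ⁻¹' {i}).ncard).bind fun n =>
        (Finset.univ.val.map fun j : Fin l => (Q ∩ d ⁻¹' {j}).ncard).map fun m => n * m := by
  rw [← Finset.map_univ_equiv (finProdFinEquiv (m := k) (n := l)), Finset.map_val,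
    Multiset.map_map, ← Finset.univ_product_univ, Finset.product_val, Multiset.bind_map]
  simp only [SProd.sprod, Multiset.product, Multiset.map_bind, Multiset.map_map]
  refine Multiset.bind_congr fun i _ => Multiset.map_congr rfl fun j _ => ?_
  exact (congrArg Set.ncard (inter_preimage_prodColouring P Q c d i j)).trans Set.ncard_prod

/-- The product of an `{n₁,…,n_k}`-midpoint-blocked set `P ⊆ ℝ²` and an
`{m₁,…,m_ℓ}`-midpoint-blocked set `Q ⊆ ℝ²` (as a point set in `ℝ⁴ = ℝ² × ℝ²`)
is `{nᵢ·mⱼ : i ∈ [k], j ∈ [ℓ]}`-midpoint-blocked. -/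
theorem product_midpoint_blocked (N M : Multiset ℕ) (P Q : Set (ℝ × ℝ))
    (hP : IsNMidpointBlocked N P) (hQ : IsNMidpointBlocked M Q) :
    IsNMidpointBlocked (N.bind fun n => M.map fun m => n * m)
      (P ×ˢ Q : Set ((ℝ × ℝ) × (ℝ × ℝ))) := by
  obtain ⟨hPfin, k, c, hc, hcmid, rfl⟩ := hP
  obtain ⟨hQfin, l, d, hd, hdmid, rfl⟩ := hQ
  exact ⟨hPfin.prod hQfin, k * l, prodColouring c d, hc.prod hd hcmid hdmid,
    fun v hv w hw _ h => midpoint_mem_prod hcmid hdmid hv hw h,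
    (map_univ_prodColouring_ncard P Q c d).symm⟩
end

section
/- For every positive integer i there exists a 4^i-blocked point set in the plane ℝ² with exactly 12^i points; that is, for every k that is a power of 4 there is a k-blocked set of k^{log₄ 12} points. -/
/-- A finite family of distinct points can be projected linearly to the plane injectively
and without creating new betweenness relations. -/
theorem exists_linearMap_plane_reflecting_openSegment {ι E : Type*} [Finite ι]
    [AddCommGroup E] [Module ℝ E] (p : ι → E) (hp : Function.Injective p) :
    ∃ L : E →ₗ[ℝ] ℝ × ℝ, Function.Injective (fun a => L (p a)) ∧
      ∀ a b x, a ≠ b → L (p x) ∈ openSegment ℝ (L (p a)) (L (p b)) →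
        p x ∈ openSegment ℝ (p a) (p b) := by
  obtain ⟨f, hf⟩ := Module.exists_dual_forall_apply_ne_zero (K := ℝ)
    (fun d : {d : ι × ι // d.1 ≠ d.2} => p d.1.2 - p d.1.1)
    (fun d h => d.2 (hp (sub_eq_zero.1 h)).symm)
  replace hf : ∀ a b, a ≠ b → f (p b - p a) ≠ 0 := fun a b h => hf ⟨(a, b), h⟩
  let y : ι × ι × ι → E := fun t =>
    f (p t.2.1 - p t.1) • (p t.2.2 - p t.1) - f (p t.2.2 - p t.1) • (p t.2.1 - p t.1)
  obtain ⟨g, hg⟩ := Module.exists_dual_forall_apply_ne_zero (K := ℝ)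
    (fun t : {t : ι × ι × ι // y t ≠ 0} => y t) (fun t => t.2)
  replace hg : ∀ t, g (y t) = 0 → y t = 0 := fun t h => by_contra fun h' => hg ⟨t, h'⟩ h
  refine ⟨f.prod g, fun a b h => ?_, fun a b x hab hx => ?_⟩
  · by_contra hab
    refine hf a b hab ?_
    have := congrArg Prod.fst h
    simp only [LinearMap.prod_apply, Function.prod] at this
    rw [map_sub, this, sub_self]
  · rw [openSegment_eq_image'] at hx ⊢
    obtain ⟨t, ht, hx⟩ := hx
    have h₁ := congrArg Prod.fst hx
    have h₂ := congrArg Prod.snd hx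
    simp only [LinearMap.prod_apply, Function.prod, Prod.fst_add, Prod.snd_add, Prod.smul_fst,
      Prod.smul_snd, Prod.fst_sub, Prod.snd_sub, smul_eq_mul] at h₁ h₂
    have hfx : f (p x - p a) = t * f (p b - p a) := by
      rw [map_sub, map_sub]; linarith
    have hgx : g (p x - p a) = t * g (p b - p a) := by
      rw [map_sub, map_sub]; linarith
    have hy : y (a, b, x) = 0 := hg _ <| by
      simp only [y]
      rw [map_sub, map_smul, map_smul, hfx, hgx, smul_eq_mul, smul_eq_mul]
      ring
    simp only [y] at hy
    rw [hfx, mul_comm, mul_smul, ← smul_sub] at hy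
    have h := (smul_eq_zero.1 hy).resolve_left (hf a b hab)
    refine ⟨t, ht, ?_⟩
    simp only [← sub_eq_zero.1 h, add_sub_cancel]

/-- Twelve lattice points, three in each residue class modulo `2`, such that points are visible
from one another exactly when they lie in different classes. -/
def latticeDozen : Fin 12 → ℤ × ℤ :=
  ![(2, 2), (2, 4), (4, 0), (0, 1), (2, 3), (4, 3), (1, 2), (3, 2), (5, 4), (1, 5), (3, 1), (3, 3)]

/-- The colour of a point of `latticeDozen`, determined by its residue class modulo `2`. -/
def latticeDozenColour : Fin 12 → Fin 4 :=
  ![0, 0, 0, 1, 1, 1, 2, 2, 2, 3, 3, 3]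

theorem latticeDozen_injective : Function.Injective latticeDozen := by
  decide

theorem latticeDozenColour_surjective : Function.Surjective latticeDozenColour := by
  decide

theorem exists_latticeDozen_add_self_eq :
    ∀ a b, latticeDozenColour a = latticeDozenColour b →
      ∃ m, latticeDozen m + latticeDozen m = latticeDozen a + latticeDozen b := by
  decide

theorem latticeDozen_colour_eq_of_between :
    ∀ a b x, ((latticeDozen x).1 - (latticeDozen a).1) * ((latticeDozen b).2 - (latticeDozen x).2) =
        ((latticeDozen x).2 - (latticeDozen a).2) * ((latticeDozen b).1 - (latticeDozen x).1) →
      0 < ((latticeDozen x).1 - (latticeDozen a).1) * ((latticeDozen b).1 - (latticeDozen x).1) +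
        ((latticeDozen x).2 - (latticeDozen a).2) * ((latticeDozen b).2 - (latticeDozen x).2) →
      latticeDozenColour a = latticeDozenColour b := by
  decide +kernel

/-- The points of `latticeDozen` as points of the real plane. -/
def planeDozen (a : Fin 12) : ℝ × ℝ :=
  ((latticeDozen a).1, (latticeDozen a).2)

theorem planeDozen_injective : Function.Injective planeDozen := by
  intro a b h
  simp only [planeDozen, Prod.mk.injEq, Int.cast_inj] at h
  exact latticeDozen_injective (Prod.ext h.1 h.2)

theorem exists_planeDozen_eq_midpoint {a b : Fin 12}
    (h : latticeDozenColour a = latticeDozenColour b) :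
    ∃ m, planeDozen m = midpoint ℝ (planeDozen a) (planeDozen b) := by
  obtain ⟨m, hm⟩ := exists_latticeDozen_add_self_eq a b h
  refine ⟨m, ?_⟩
  rw [eq_comm, midpoint_eq_iff']
  have h₁ : ((latticeDozen m).1 + (latticeDozen m).1 : ℝ) =
      (latticeDozen a).1 + (latticeDozen b).1 := by
    exact_mod_cast congrArg Prod.fst hm
  have h₂ : ((latticeDozen m).2 + (latticeDozen m).2 : ℝ) =
      (latticeDozen a).2 + (latticeDozen b).2 := by
    exact_mod_cast congrArg Prod.snd hm
  rw [Equiv.pointReflection_apply, vsub_eq_sub, vadd_eq_add]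
  ext <;> simp only [planeDozen, Prod.fst_add, Prod.fst_sub, Prod.snd_add, Prod.snd_sub] <;>
    linarith

theorem latticeDozenColour_eq_of_mem_openSegment {a b x : Fin 12}
    (hx : planeDozen x ∈ openSegment ℝ (planeDozen a) (planeDozen b)) :
    latticeDozenColour a = latticeDozenColour b := by
  by_cases hab : a = b
  · rw [hab]
  rw [openSegment_eq_image'] at hx
  obtain ⟨t, ⟨ht₀, ht₁⟩, hx⟩ := hx
  have h₁ := congrArg Prod.fst hx
  have h₂ := congrArg Prod.snd hx
  simp only [planeDozen, Prod.fst_add, Prod.snd_add, Prod.smul_fst, Prod.smul_snd, Prod.fst_sub,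
    Prod.snd_sub, smul_eq_mul] at h₁ h₂
  refine latticeDozen_colour_eq_of_between a b x ?_ ?_
  · rify
    rw [← h₁, ← h₂]
    ring
  · rify
    rw [← h₁, ← h₂]
    have hd : 0 < ((latticeDozen b).1 - (latticeDozen a).1 : ℝ) ^ 2 +
        ((latticeDozen b).2 - (latticeDozen a).2 : ℝ) ^ 2 := by
      refine lt_of_le_of_ne (by positivity) fun h => hab ?_
      have e₁ : ((latticeDozen b).1 - (latticeDozen a).1 : ℝ) = 0 := by
        rw [← sq_eq_zero_iff]; nlinarith
      have e₂ : ((latticeDozen b).2 - (latticeDozen a).2 : ℝ) = 0 := by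
        rw [← sq_eq_zero_iff]; nlinarith
      exact planeDozen_injective (Prod.ext (sub_eq_zero.1 e₁).symm (sub_eq_zero.1 e₂).symm)
    have := mul_pos (mul_pos ht₀ (sub_pos.2 ht₁)) hd
    linarith

/-- For every positive integer `i`, there is a `4^i`-blocked planar point set
(with every colour used) having exactly `12^i` points. -/
theorem large_k_blocked_sets (i : ℕ) (hi : 0 < i) :
    ∃ P : Set (ℝ × ℝ), P.Finite ∧ P.ncard = 12 ^ i ∧
      ∃ c : (ℝ × ℝ) → Fin (4 ^ i), BlockedColouring P c ∧
        ∀ j : Fin (4 ^ i), ∃ p ∈ P, c p = j := by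
  let p : (Fin i → Fin 12) → Fin i → ℝ × ℝ := fun a j => planeDozen (a j)
  have hp : Function.Injective p := planeDozen_injective.comp_left
  obtain ⟨L, hL, hseg⟩ := exists_linearMap_plane_reflecting_openSegment p hp
  let κ : (Fin i → Fin 12) → Fin (4 ^ i) := fun a =>
    finFunctionFinEquiv fun j => latticeDozenColour (a j)
  let c : ℝ × ℝ → Fin (4 ^ i) := Function.extend (fun a => L (p a)) κ fun _ => κ 0
  have hc : ∀ a, c (L (p a)) = κ a := fun a => hL.extend_apply κ _ a
  refine ⟨Set.range fun a => L (p a), Set.finite_range _, ?_, c, ?_, fun j => ?_⟩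
  · rw [← Nat.card_coe_set_eq, Nat.card_range_of_injective hL]
    simp
  · rintro _ ⟨a, rfl⟩ _ ⟨b, rfl⟩ hab
    have hne : a ≠ b := fun h => hab (by rw [h])
    change _ ↔ c (L (p a)) ≠ c (L (p b))
    rw [hc, hc]
    constructor
    · intro hvis hκ
      have hκ' : ∀ j, latticeDozenColour (a j) = latticeDozenColour (b j) :=
        congrFun (finFunctionFinEquiv.injective hκ)
      choose m hm using fun j => exists_planeDozen_eq_midpoint (hκ' j)
      refine hvis _ ⟨m, rfl⟩ ?_
      have hpm : p m = midpoint ℝ (p a) (p b) := by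
        funext j
        simp only [p, hm, pi_midpoint_apply]
      have hLm : L (p m) = midpoint ℝ (L (p a)) (L (p b)) := by
        rw [hpm]
        exact L.toAffineMap.map_midpoint _ _
      simp only [Blocks, hLm]
      exact midpoint_mem_openSegment _ _
    · rintro hκ _ ⟨x, rfl⟩ hx
      refine hκ (congrArg finFunctionFinEquiv (funext fun j => ?_))
      refine latticeDozenColour_eq_of_mem_openSegment (x := x j) ?_
      obtain ⟨s, t, hs, ht, hst, h⟩ := hseg a b x hne hx
      exact ⟨s, t, hs, ht, hst, congrFun h j⟩
  · choose r hr using latticeDozenColour_surjective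
    refine ⟨_, ⟨fun l => r (finFunctionFinEquiv.symm j l), rfl⟩, ?_⟩
    change c (L (p _)) = j
    rw [hc]
    simp [κ, hr]
end
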